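/- arXiv:2111.08847 — 2 statements merged into one kernel-verified Lean document; each statement's English description precedes it below -/
import Mathlib

section
/- Let p and q be primes with p < q such that: (i) p ≡ q (mod 8) and p ≡ 3 or 7 (mod 8); (ii) gcd(p−1, q−1) = 2; (iii) q is a primitive root modulo p². Suppose further that a third prime r is a primitive root modulo p² and modulo q². Then for every exponent a ≥ 1 there exist exponents b and c (with p^a, q^b, r^c > 2) such that the coefficient set A_{p^a,q^b,r^c} of Φ*_{p^a q^b r^c} equals exactly the set of integers n with −(p^a−1)/2 ≤ n ≤ (p^a+1)/2. -/
open Polynomial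

/-- The ternary inclusion-exclusion polynomial `Q_{p,q,r}`. -/
noncomputable def Qpoly (p q r : ℕ) : Polynomial ℤ :=
  ((X ^ (p * q * r) - 1) * (X ^ p - 1) * (X ^ q - 1) * (X ^ r - 1)) /ₘ
    ((X ^ (p * q) - 1) * (X ^ (q * r) - 1) * (X ^ (r * p) - 1) * (X - 1))

/-- The set `A_{p,q,r}` of coefficients of `Q_{p,q,r}` (whose degree is `(p-1)(q-1)(r-1)`). -/
noncomputable def coeffSet (p q r : ℕ) : Set ℤ :=
  {n : ℤ | ∃ m : ℕ, m ≤ (p - 1) * (q - 1) * (r - 1) ∧ (Qpoly p q r).coeff m = n}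

/-- `g` is a primitive root modulo `m`: it generates the multiplicative group of `ZMod m`. -/
def IsPrimRootMod (g m : ℕ) : Prop :=
  IsUnit (g : ZMod m) ∧ ∀ x : (ZMod m)ˣ, ∃ i : ℕ, (g : ZMod m) ^ i = (x : ZMod m)

/-- Odd `P = 2 * h + 1`, and `Q ≡ 1 (mod P)` large enough, with `δ = (P + Q) / 2`. -/
structure IsWindow (h : ℕ) (k P Q δ : ℤ) : Prop where
  one_le : 1 ≤ h
  lt_k : (h : ℤ) < k
  hP : P = 2 * h + 1
  hQ : Q = 1 + 2 * k * P
  hδ : δ = h + 1 + k * P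

lemma add_mul_emod_mul {P Q f g : ℤ} (hP : 0 < P) (h0 : 0 ≤ f) (hf : f < Q) :
    (f + g * Q) % (P * Q) = f + g % P * Q := by
  have h1 : f + g * Q = (f + g % P * Q) + P * Q * (g / P) := by
    linear_combination Q * (Int.mul_ediv_add_emod g P).symm
  have h2 := Int.emod_nonneg g hP.ne'
  have h3 := Int.emod_lt_of_pos g hP
  have hQ : 0 < Q := by omega
  rw [h1, Int.add_mul_emod_self_left, Int.emod_eq_of_lt]
  · positivity
  · nlinarith

lemma add_emod_of_lt {P g y : ℤ} (hy : 0 ≤ y) (hyP : y < P) (hlt : g % P < (g + y) % P) :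
    g % P + y < P := by
  have g0 := Int.emod_nonneg g (by omega : P ≠ 0)
  have g1 := Int.emod_lt_of_pos g (by omega : 0 < P)
  by_contra! hcon
  have e : g + y = (g % P + y - P) + P * (g / P + 1) := by
    linear_combination (Int.mul_ediv_add_emod g P).symm
  rw [e, Int.add_mul_emod_self_left, Int.emod_eq_of_lt (a := g % P + y - P) (by omega) (by omega)]
    at hlt
  omega

namespace IsWindow

variable {h : ℕ} {k P Q δ : ℤ}

lemma P_pos (H : IsWindow h k P Q δ) : 0 < P := by have := H.hP; omega

lemma two_δ (H : IsWindow h k P Q δ) : 2 * δ = P + Q := by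
  rw [H.hδ, H.hQ, H.hP]; ring

lemma add_lt (H : IsWindow h k P Q δ) : h * P + δ < Q := by
  have h1 := H.P_pos
  have h2 := H.lt_k
  have h3 := H.hP
  have : (h + 1) * P ≤ k * P := by gcongr; omega
  rw [H.hδ, H.hQ]; nlinarith

lemma P_lt (H : IsWindow h k P Q δ) : P < Q := by
  have h1 := H.add_lt
  have h2 := H.two_δ
  have : 0 ≤ (h : ℤ) * P := mul_nonneg (by positivity) H.P_pos.le
  omega

lemma Q_pos (H : IsWindow h k P Q δ) : 0 < Q := H.P_pos.trans H.P_lt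

lemma dvd_Q_sub_one (H : IsWindow h k P Q δ) : P ∣ Q - 1 := ⟨2 * k, by rw [H.hQ]; ring⟩

lemma dvd_δ_sub (H : IsWindow h k P Q δ) : P ∣ δ - (h + 1) := ⟨k, by rw [H.hδ]; ring⟩

/-- Two points of a window which are `1` modulo `P` after reduction modulo `Q` are an even number
of steps apart, and there is no carry between them. -/
lemma exists_eq_two_mul (H : IsWindow h k P Q δ) {w : ℤ} {d : ℕ} (hd : d ≤ 2 * h)
    (hw : w % Q % P = 1) (hw' : (w + d * δ) % Q % P = 1) :
    ∃ e : ℕ, d = 2 * e ∧ w % Q + e * P < Q := by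
  have hP := H.hP
  have hPp := H.P_pos
  have h1 := H.one_le
  have hQp := H.Q_pos
  have hadd := H.add_lt
  have hδ2 := H.two_δ
  have hf0 := Int.emod_nonneg w hQp.ne'
  have hf1 := Int.emod_lt_of_pos w hQp
  have hwf := Int.mul_ediv_add_emod w Q
  generalize w % Q = f at *
  generalize w / Q = g at *
  subst hwf
  have hf : P ∣ f - 1 := Int.dvd_self_sub_of_emod_eq hw
  have key : ∀ x c : ℤ, Q * g + f + d * δ = x + Q * c → 0 ≤ x → x < Q → P ∣ x - 1 := by
    intro x c hx hx0 hx1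
    rw [hx, Int.add_mul_emod_self_left, Int.emod_eq_of_lt hx0 hx1] at hw'
    exact Int.dvd_self_sub_of_emod_eq hw'
  have small : ∀ x : ℤ, P ∣ x → -P < x → x < P → x = 0 := fun x hx h2 h3 =>
    Int.eq_zero_of_abs_lt_dvd hx (abs_lt.2 ⟨h2, h3⟩)
  obtain ⟨e, rfl | rfl⟩ := Nat.even_or_odd' d
  · refine ⟨e, rfl, ?_⟩
    have he : (e : ℤ) * P ≤ h * P := by gcongr; omega
    have he0 : 0 ≤ (e : ℤ) * P := by positivity
    by_contra! hcon
    have := key (f + e * P - Q) (g + e + 1) (by push_cast; linear_combination (e : ℤ) * hδ2)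
      (by omega) (by nlinarith)
    have h2 : P ∣ 1 := by
      have := ((hf.sub this).add (Dvd.intro_left (e : ℤ) rfl)).sub H.dvd_Q_sub_one
      rwa [show f - 1 - (f + e * P - Q - 1) + e * P - (Q - 1) = 1 by ring] at this
    have := small 1 h2 (by omega) (by omega)
    omega
  · exfalso
    have he : (e : ℤ) * P ≤ h * P := by gcongr; omega
    have he0 : 0 ≤ (e : ℤ) * P := by positivity
    by_cases hc : f + e * P + δ < Q
    · have := key (f + e * P + δ) (g + e) (by push_cast; linear_combination (e : ℤ) * hδ2)
        (by omega) hc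
      have h2 : P ∣ (h + 1 : ℤ) := by
        have := ((this.sub hf).sub (Dvd.intro_left (e : ℤ) rfl)).sub H.dvd_δ_sub
        rwa [show f + e * P + δ - 1 - (f - 1) - e * P - (δ - (h + 1)) = h + 1 by ring] at this
      have := small _ h2 (by omega) (by omega)
      omega
    · have := key (f + e * P + δ - Q) (g + e + 1)
        (by push_cast; linear_combination (e : ℤ) * hδ2) (by omega) (by omega)
      have h2 : P ∣ (h : ℤ) := by
        have := (((this.sub hf).sub (Dvd.intro_left (e : ℤ) rfl)).sub H.dvd_δ_sub).add
          H.dvd_Q_sub_one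
        rwa [show f + e * P + δ - Q - 1 - (f - 1) - e * P - (δ - (h + 1)) + (Q - 1) = h by ring]
          at this
      have := small _ h2 (by omega) (by omega)
      omega

/-- Points of the window counted with sign `-1`, respectively `+1` after exchanging `w` and its
translate. -/
lemma not_both_ends (H : IsWindow h k P Q δ) {N z : ℤ}
    (h0 : z % Q % P = 1) (h1 : z % (P * Q) ≤ N) (h2 : N < (z + (h + 1) * Q) % (P * Q))
    (h0' : (z + (2 * h : ℕ) * δ) % Q % P = 1) (h1' : (z + (2 * h : ℕ) * δ) % (P * Q) ≤ N)
    (h2' : N < (z + (2 * h : ℕ) * δ + (h + 1) * Q) % (P * Q)) : False := by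
  obtain ⟨e, he, hlt⟩ := H.exists_eq_two_mul le_rfl h0 h0'
  obtain rfl : h = e := by omega
  have hP := H.hP
  have hPp := H.P_pos
  have hQp := H.Q_pos
  have hδ2 := H.two_δ
  have hf0 := Int.emod_nonneg z hQp.ne'
  have hf1 := Int.emod_lt_of_pos z hQp
  have hwf := Int.mul_ediv_add_emod z Q
  have hhP : 0 ≤ (h : ℤ) * P := by positivity
  generalize z % Q = f at *
  generalize z / Q = g at *
  have hz : z = f + g * Q := by rw [← hwf]; ring
  have e1 : z + (h + 1) * Q = f + (g + h + 1) * Q := by rw [hz]; ring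
  have e2 : z + (2 * h : ℕ) * δ = (f + h * P) + (g + h) * Q := by
    rw [hz]; push_cast; linear_combination (h : ℤ) * hδ2
  have e3 : z + (2 * h : ℕ) * δ + (h + 1) * Q = (f + h * P) + (g + P) * Q := by
    rw [e2, hP]; ring
  rw [e1, add_mul_emod_mul hPp hf0 hf1] at h2
  rw [hz, add_mul_emod_mul hPp hf0 hf1] at h1
  rw [e2, add_mul_emod_mul hPp (by omega) hlt] at h1'
  rw [e3, add_mul_emod_mul hPp (by omega) hlt, Int.add_emod_right] at h2'
  have i1 : g % P < (g + h + 1) % P := lt_of_mul_lt_mul_right (by linarith) hQp.le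
  have i2 : (g + h) % P < g % P := lt_of_mul_lt_mul_right (by linarith) hQp.le
  have g0 := Int.emod_nonneg g hPp.ne'
  have g1 := Int.emod_lt_of_pos g hPp
  rw [add_assoc] at i1
  have i3 := add_emod_of_lt (y := (h : ℤ) + 1) (by omega) (by have := H.one_le; omega) i1
  rw [Int.add_emod g, Int.emod_eq_of_lt (a := (h : ℤ)) (by omega) (by omega)] at i2
  rw [Int.emod_eq_of_lt (by omega) (by omega)] at i2
  omega

lemma not_both_ends' (H : IsWindow h k P Q δ) {N z : ℤ}
    (h0 : z % Q % P = 1) (h1 : N < z % (P * Q))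
    (h0' : (z + (2 * h : ℕ) * δ) % Q % P = 1)
    (h2' : (z + (2 * h : ℕ) * δ + (h + 1) * Q) % (P * Q) ≤ N) : False := by
  obtain ⟨e, he, hlt⟩ := H.exists_eq_two_mul le_rfl h0 h0'
  obtain rfl : h = e := by omega
  have hPp := H.P_pos
  have hQp := H.Q_pos
  have hf0 := Int.emod_nonneg z hQp.ne'
  have hf1 := Int.emod_lt_of_pos z hQp
  have hwf := Int.mul_ediv_add_emod z Q
  have hhP : 0 ≤ (h : ℤ) * P := by positivity
  generalize z % Q = f at *
  generalize z / Q = g at *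
  have hz : z = f + g * Q := by rw [← hwf]; ring
  have e3 : z + (2 * h : ℕ) * δ + (h + 1) * Q = (f + h * P) + (g + P) * Q := by
    rw [hz, H.hP]; push_cast; have := H.two_δ; rw [H.hP] at this; linear_combination (h : ℤ) * this
  rw [hz, add_mul_emod_mul hPp hf0 hf1] at h1
  rw [e3, add_mul_emod_mul hPp (by omega) hlt, Int.add_emod_right] at h2'
  omega

end IsWindow

/-- Indicator of the `+1` coefficients of the binary polynomial, truncated at `N`. -/
def plusInd (P Q N z : ℤ) : ℤ := if P ∣ z ∧ z % (P * Q) ≤ N then 1 else 0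

/-- Indicator of the `-1` coefficients of the binary polynomial, truncated at `N`. -/
def minusInd (P Q N z : ℤ) : ℤ := if z % Q % P = 1 ∧ z % (P * Q) ≤ N then 1 else 0

/-- The truncated binary coefficient at `z`, periodic in `z`. -/
def truncCoeff (P Q N z : ℤ) : ℤ := plusInd P Q N z - minusInd P Q N z

/-- The sum of the truncated binary coefficients over the window starting at `z`, minus the sum
over its translate. -/
def windowSum (h : ℕ) (P Q δ N z : ℤ) : ℤ :=
  ∑ m ∈ Finset.range (2 * h + 1),
    (truncCoeff P Q N (z + m * δ) - truncCoeff P Q N (z + m * δ + (h + 1) * Q))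

lemma card_le_of_even_gaps {h : ℕ} {V : Finset ℕ} (hV : V ⊆ Finset.range (2 * h + 1))
    (hgap : ∀ m d, m ∈ V → m + d ∈ V → Even d) (hends : ¬ (0 ∈ V ∧ 2 * h ∈ V)) :
    V.card ≤ h ∧ (V.card = h → ∃ ε ≤ 2, ∀ l < h, ε + 2 * l ∈ V) := by
  obtain ⟨ε, hε, hsub⟩ : ∃ ε ≤ 2, V ⊆ (Finset.range h).image (fun l => ε + 2 * l) := by
    by_cases hodd : ∃ m ∈ V, Odd m
    · obtain ⟨m, hm, hmo⟩ := hodd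
      refine ⟨1, by norm_num, fun x hx => ?_⟩
      have hxo : Odd x := by
        rcases le_total m x with hle | hle
        · have := hgap m (x - m) hm (by rwa [Nat.add_sub_cancel' hle])
          rw [← Nat.add_sub_cancel' hle]
          exact hmo.add_even this
        · have := hgap x (m - x) hx (by rwa [Nat.add_sub_cancel' hle])
          rw [← Nat.add_sub_cancel' hle] at hmo
          by_contra hcon
          exact (Nat.not_odd_iff_even.2 ((Nat.not_odd_iff_even.1 hcon).add this)) hmo
      obtain ⟨l, rfl⟩ := hxo
      have := Finset.mem_range.1 (hV hx)
      exact Finset.mem_image.2 ⟨l, Finset.mem_range.2 (by omega), by omega⟩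
    · have heven : ∀ x ∈ V, ∃ l, x = 2 * l := fun x hx => by
        obtain ⟨l, hl⟩ := Nat.not_odd_iff_even.1 fun ho => hodd ⟨x, hx, ho⟩
        exact ⟨l, by omega⟩
      by_cases h0 : 0 ∈ V
      · refine ⟨0, by norm_num, fun x hx => ?_⟩
        obtain ⟨l, rfl⟩ := heven x hx
        have := Finset.mem_range.1 (hV hx)
        have hne : l ≠ h := by rintro rfl; exact hends ⟨h0, hx⟩
        exact Finset.mem_image.2 ⟨l, Finset.mem_range.2 (by omega), by omega⟩
      · refine ⟨2, le_rfl, fun x hx => ?_⟩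
        obtain ⟨l, rfl⟩ := heven x hx
        have := Finset.mem_range.1 (hV hx)
        have hne : l ≠ 0 := by rintro rfl; exact h0 hx
        exact Finset.mem_image.2 ⟨l - 1, Finset.mem_range.2 (by omega), by omega⟩
  have hcard : ((Finset.range h).image (fun l => ε + 2 * l)).card = h := by
    rw [Finset.card_image_of_injective _ (fun a b hab => by simpa using hab), Finset.card_range]
  refine ⟨(Finset.card_le_card hsub).trans hcard.le, fun hc => ⟨ε, hε, fun l hl => ?_⟩⟩
  rw [Finset.eq_of_subset_of_card_le hsub (by omega)]
  exact Finset.mem_image_of_mem _ (Finset.mem_range.2 hl)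

namespace IsWindow

variable {h : ℕ} {k P Q δ : ℤ}

lemma windowSum_eq (h : ℕ) (P Q δ N z : ℤ) : windowSum h P Q δ N z =
    (∑ m ∈ Finset.range (2 * h + 1), plusInd P Q N (z + m * δ)) -
    (∑ m ∈ Finset.range (2 * h + 1), plusInd P Q N (z + (h + 1) * Q + m * δ)) +
    ∑ m ∈ Finset.range (2 * h + 1),
      (minusInd P Q N (z + m * δ + (h + 1) * Q) - minusInd P Q N (z + m * δ)) := by
  rw [← Finset.sum_sub_distrib, ← Finset.sum_add_distrib]
  refine Finset.sum_congr rfl fun m _ => ?_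
  rw [truncCoeff, truncCoeff, add_right_comm z]
  ring

lemma dvd_add_mul_δ_iff (H : IsWindow h k P Q δ) (z m : ℤ) : P ∣ z + m * δ ↔ P ∣ 2 * z + m := by
  have hP := H.hP
  have e1 : 2 * (z + m * δ) = 2 * z + m + P * (m * (1 + 2 * k)) := by
    rw [mul_add, mul_left_comm, H.two_δ, H.hQ]; ring
  have e2 : z + m * δ = (h + 1) * (2 * z + m) +
      P * ((h + 1) * (m * (1 + 2 * k)) - (z + m * δ)) := by
    linear_combination ((h : ℤ) + 1) * e1 + (z + m * δ) * hP
  constructor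
  · intro hd
    rw [← Int.dvd_add_left (Dvd.intro _ rfl : P ∣ P * (m * (1 + 2 * k))), ← e1]
    exact hd.mul_left _
  · intro hd
    rw [e2]
    exact (hd.mul_left _).add (Dvd.intro _ rfl)

lemma sum_plusInd (H : IsWindow h k P Q δ) (N z v : ℤ) (hv0 : 0 ≤ v) (hv1 : v < P)
    (hv : P ∣ 2 * z + v) :
    ∑ m ∈ Finset.range (2 * h + 1), plusInd P Q N (z + m * δ) =
      if (z + v * δ) % (P * Q) ≤ N then 1 else 0 := by
  have hP := H.hP
  lift v to ℕ using hv0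
  rw [Finset.sum_eq_single v]
  · simp [plusInd, (H.dvd_add_mul_δ_iff z v).2 hv]
  · intro m hm hmv
    rw [plusInd, if_neg]
    rintro ⟨h1, -⟩
    rw [H.dvd_add_mul_δ_iff] at h1
    have h2 := h1.sub hv
    rw [add_sub_add_left_eq_sub] at h2
    have := Finset.mem_range.1 hm
    have := Int.eq_zero_of_abs_lt_dvd h2 (abs_lt.2 ⟨by omega, by omega⟩)
    omega
  · intro hm
    exact absurd (Finset.mem_range.2 (by omega)) hm

lemma sum_plusInd_mem (H : IsWindow h k P Q δ) (N z : ℤ) :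
    0 ≤ ∑ m ∈ Finset.range (2 * h + 1), plusInd P Q N (z + m * δ) ∧
      ∑ m ∈ Finset.range (2 * h + 1), plusInd P Q N (z + m * δ) ≤ 1 := by
  have hP := H.P_pos
  rw [H.sum_plusInd N z _ (Int.emod_nonneg (-(2 * z)) hP.ne') (Int.emod_lt_of_pos _ hP)
    (Int.dvd_of_emod_eq_zero (by rw [Int.add_emod_emod, add_neg_cancel, Int.zero_emod]))]
  split_ifs <;> simp

/-- When a long chain of `-1`s starts in the bottom stage, the `+1`s do not contribute
negatively. -/
lemma sum_plusInd_le (H : IsWindow h k P Q δ) {N z f g : ℤ} {ε : ℕ} (hε : ε ≤ 2)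
    (hz : z + ε * δ = f + P * Q * g) (hf0 : 0 ≤ f) (hf : f % P = 1) (hfQ : f + (h - 1) * P < Q) :
    ∑ m ∈ Finset.range (2 * h + 1), plusInd P Q N (z + (h + 1) * Q + m * δ) ≤
      ∑ m ∈ Finset.range (2 * h + 1), plusInd P Q N (z + m * δ) := by
  have hP := H.hP
  have h1 : (1 : ℤ) ≤ h := by exact_mod_cast H.one_le
  have hPp := H.P_pos
  have hQp := H.Q_pos
  have hPQ := H.P_lt
  have hδ2 := H.two_δ
  have hδQ : δ < Q := by omega
  have hδ0 : 0 < δ := by omega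
  have hQk := H.hQ
  have hhP : 0 ≤ ((h : ℤ) - 1) * P := mul_nonneg (by omega) hPp.le
  have hhQ : 0 ≤ ((h : ℤ) - 1) * Q := mul_nonneg (by omega) hQp.le
  have hPQe : P * Q = 2 * h * Q + Q := by rw [hP]; ring
  obtain ⟨u, hu⟩ := Int.dvd_self_sub_of_emod_eq hf
  rw [H.sum_plusInd N (z + (h + 1) * Q) (2 * h - 2 + ε) (by omega) (by omega) ⟨2 * u +
    2 * Q * g - ε * (1 + 2 * k) + Q + 2 * k + 1, by
      linear_combination 2 * hz + 2 * hu - ε * hδ2 - ε * hQk + hQk - (Q + 1) * hP⟩]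
  have e1 : (z + (h + 1) * Q + (2 * h - 2 + ε) * δ) % (P * Q) = f + (h - 1) * P + 2 * h * Q := by
    rw [show z + (h + 1) * Q + (2 * h - 2 + ε) * δ = f + (h - 1) * P + 2 * h * Q + P * Q * g by
      linear_combination hz + (h - 1) * hδ2, Int.add_mul_emod_self_left, Int.emod_eq_of_lt]
    · positivity
    · linarith
  rw [e1]
  obtain ⟨v, hv0, hv1, hv, x, hx, hx0, hxle⟩ : ∃ v : ℤ, 0 ≤ v ∧ v < P ∧ P ∣ 2 * z + v ∧
      ∃ x, (∃ c, z + v * δ = x + P * Q * c) ∧ 0 ≤ x ∧ x ≤ f + (h - 1) * P + 2 * h * Q := by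
    by_cases h2 : ε = 2
    · subst h2
      refine ⟨0, le_rfl, hPp, ⟨2 * u + 2 * Q * g - 2 * (1 + 2 * k), ?_⟩, f - P - Q + P * Q,
        ⟨g - 1, ?_⟩, ?_, ?_⟩
      · push_cast at hz
        linear_combination 2 * hz + 2 * hu - 2 * hδ2 - 2 * hQk
      · push_cast at hz
        linear_combination hz - hδ2
      · linarith
      · linarith
    · refine ⟨2 * h - 1 + ε, by omega, by omega, ⟨2 * u + 2 * Q * g - ε * (1 + 2 * k) + 1, ?_⟩,
        f + (2 * h - 1) * δ, ⟨g, ?_⟩, ?_, ?_⟩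
      · linear_combination 2 * hz + 2 * hu - ε * hδ2 - ε * hQk - hP
      · linear_combination hz
      · have : 0 ≤ (2 * (h : ℤ) - 1) * δ := mul_nonneg (by omega) hδ0.le
        linarith
      · have : (2 * (h : ℤ) - 1) * δ = (h - 1) * (P + Q) + δ := by
          linear_combination (h - 1) * hδ2
        linarith
  rw [H.sum_plusInd N z v hv0 hv1 hv]
  obtain ⟨c, hc⟩ := hx
  rw [hc, Int.add_mul_emod_self_left, Int.emod_eq_of_lt hx0 (by linarith)]
  split_ifs <;> omega

lemma even_gap (H : IsWindow h k P Q δ) {z : ℤ} {m d : ℕ} (hd : m + d ≤ 2 * h)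
    (h1 : (z + m * δ) % Q % P = 1) (h2 : (z + (m + d : ℕ) * δ) % Q % P = 1) : Even d := by
  obtain ⟨e, he, -⟩ := H.exists_eq_two_mul (w := z + m * δ) (d := d) (by omega) h1
    (by rwa [add_assoc, ← add_mul, ← Nat.cast_add])
  exact ⟨e, by omega⟩

lemma sum_minusInd_le (H : IsWindow h k P Q δ) (N z : ℤ) :
    ∑ m ∈ Finset.range (2 * h + 1),
      (minusInd P Q N (z + m * δ + (h + 1) * Q) - minusInd P Q N (z + m * δ)) ≤ h := by
  set V := (Finset.range (2 * h + 1)).filter (fun m : ℕ => (z + m * δ) % Q % P = 1 ∧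
    N < (z + m * δ) % (P * Q) ∧ (z + m * δ + (h + 1) * Q) % (P * Q) ≤ N) with hV
  have hcard := (card_le_of_even_gaps (h := h) (V := V) (Finset.filter_subset _ _) ?_ ?_).1
  · refine le_trans (Finset.sum_le_sum (g := fun m : ℕ => if (z + m * δ) % Q % P = 1 ∧
      N < (z + m * δ) % (P * Q) ∧ (z + m * δ + (h + 1) * Q) % (P * Q) ≤ N then (1 : ℤ) else 0) ?_)
      ?_
    · intro m _
      rw [minusInd, minusInd, Int.add_mul_emod_self_right]
      split_ifs <;> omega
    · rw [Finset.sum_boole]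
      exact_mod_cast hcard
  · intro m d hm hmd
    simp only [hV, Finset.mem_filter, Finset.mem_range] at hm hmd
    exact H.even_gap (by omega) hm.2.1 hmd.2.1
  · rintro ⟨h0, h1⟩
    simp only [hV, Finset.mem_filter, Finset.mem_range] at h0 h1
    exact H.not_both_ends' (by simpa using h0.2.1) (by simpa using h0.2.2.1) h1.2.1 h1.2.2.2

lemma windowSum_le (H : IsWindow h k P Q δ) (N z : ℤ) : windowSum h P Q δ N z ≤ h + 1 := by
  rw [windowSum_eq]
  have h1 := H.sum_minusInd_le N z
  have h2 := H.sum_plusInd_mem N z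
  have h3 := H.sum_plusInd_mem N (z + (h + 1) * Q)
  linarith [h1, h2.2, h3.1]

/-- A chain of `h` terms `-1` starts in the bottom stage. -/
lemma exists_bottom (H : IsWindow h k P Q δ) {N w : ℤ}
    (hw : ∀ l < h, (w + (2 * l : ℕ) * δ) % Q % P = 1 ∧ (w + (2 * l : ℕ) * δ) % (P * Q) ≤ N ∧
      N < (w + (2 * l : ℕ) * δ + (h + 1) * Q) % (P * Q)) :
    ∃ f g, w = f + P * Q * g ∧ 0 ≤ f ∧ f % P = 1 ∧ f + (h - 1) * P < Q := by
  have hP := H.hP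
  have hPp := H.P_pos
  have hQp := H.Q_pos
  have hδ2 := H.two_δ
  have h1 := H.one_le
  have hf0 := Int.emod_nonneg w hQp.ne'
  have hf1 := Int.emod_lt_of_pos w hQp
  have hwf := Int.mul_ediv_add_emod w Q
  have hw0 := hw 0 (by omega)
  simp only [mul_zero, Nat.cast_zero, zero_mul, add_zero] at hw0
  have hch : ∀ l : ℕ, l < h → w % Q + l * P < Q := fun l hl => by
    obtain ⟨e, he, hlt⟩ := H.exists_eq_two_mul (w := w) (d := 2 * l) (by omega) hw0.1 (hw l hl).1
    obtain rfl : e = l := by omega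
    exact hlt
  generalize w % Q = f at *
  generalize w / Q = g at *
  have hz : w = f + g * Q := by rw [← hwf]; ring
  have g0 := Int.emod_nonneg g hPp.ne'
  have g1 := Int.emod_lt_of_pos g hPp
  have hgP := Int.mul_ediv_add_emod g P
  have e1 : ∀ l : ℕ, l < h → (w + (2 * l : ℕ) * δ) % (P * Q) = f + l * P + (g + l) % P * Q := by
    intro l hl
    rw [← add_mul_emod_mul hPp (by positivity) (hch l hl)]
    congr 1
    rw [hz]; push_cast; linear_combination (l : ℤ) * hδ2
  have e2 : ∀ l : ℕ, l < h → (w + (2 * l : ℕ) * δ + (h + 1) * Q) % (P * Q) =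
      f + l * P + (g + l + (h + 1)) % P * Q := by
    intro l hl
    rw [← add_mul_emod_mul hPp (by positivity) (hch l hl)]
    congr 1
    rw [hz]; push_cast; linear_combination (l : ℤ) * hδ2
  have key : ∀ l : ℕ, l < h → (g + l) % P < (g + l + (h + 1)) % P := by
    intro l hl
    have := hw l hl
    rw [e1 l hl, e2 l hl] at this
    exact lt_of_mul_lt_mul_right (by linarith [this.2.1, this.2.2]) hQp.le
  have k0 := key 0 (by omega)
  simp only [Nat.cast_zero, add_zero] at k0
  have k1 := add_emod_of_lt (by omega) (by omega) k0
  have hg : g % P = 0 := by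
    by_contra hne
    obtain ⟨l, hl⟩ : ∃ l : ℕ, (l : ℤ) = h - g % P := ⟨(h - g % P).toNat, by omega⟩
    have k2 := key l (by omega)
    rw [show g + l + (h + 1) = 0 + P * (g / P + 1) by linarith, Int.add_mul_emod_self_left,
      Int.zero_emod] at k2
    have := Int.emod_nonneg (g + l) hPp.ne'
    omega
  refine ⟨f, g / P, ?_, hf0, hw0.1, ?_⟩
  · rw [hg] at hgP
    linear_combination hz - Q * hgP
  · have := hch (h - 1) (by omega)
    rwa [Nat.cast_sub h1, Nat.cast_one] at this

lemma le_windowSum (H : IsWindow h k P Q δ) (N z : ℤ) : -(h : ℤ) ≤ windowSum h P Q δ N z := by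
  rw [windowSum_eq]
  set V := (Finset.range (2 * h + 1)).filter (fun m : ℕ => (z + m * δ) % Q % P = 1 ∧
    (z + m * δ) % (P * Q) ≤ N ∧ N < (z + m * δ + (h + 1) * Q) % (P * Q)) with hV
  have hcard := card_le_of_even_gaps (h := h) (V := V) (Finset.filter_subset _ _) ?_ ?_
  · have hsum : -(V.card : ℤ) ≤ ∑ m ∈ Finset.range (2 * h + 1),
        (minusInd P Q N (z + m * δ + (h + 1) * Q) - minusInd P Q N (z + m * δ)) := by
      rw [hV, ← Finset.sum_boole, ← Finset.sum_neg_distrib]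
      refine Finset.sum_le_sum fun m _ => ?_
      rw [minusInd, minusInd, Int.add_mul_emod_self_right]
      split_ifs <;> omega
    rcases hcard.1.lt_or_eq with hlt | heq
    · have h2 := H.sum_plusInd_mem N z
      have h3 := H.sum_plusInd_mem N (z + (h + 1) * Q)
      have : (V.card : ℤ) + 1 ≤ h := by exact_mod_cast hlt
      linarith [h2.1, h3.2]
    · obtain ⟨ε, hε, hmem⟩ := hcard.2 heq
      have hmem' : ∀ l < h, (z + ε * δ + (2 * l : ℕ) * δ) % Q % P = 1 ∧
          (z + ε * δ + (2 * l : ℕ) * δ) % (P * Q) ≤ N ∧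
          N < (z + ε * δ + (2 * l : ℕ) * δ + (h + 1) * Q) % (P * Q) := by
        intro l hl
        have := (Finset.mem_filter.1 (hV ▸ hmem l hl)).2
        rwa [Nat.cast_add, add_mul, ← add_assoc] at this
      obtain ⟨f, g, hw, hf0, hf, hfQ⟩ := H.exists_bottom hmem'
      have := H.sum_plusInd_le (N := N) hε hw hf0 hf hfQ
      rw [heq] at hsum
      linarith
  · intro m d hm hmd
    simp only [hV, Finset.mem_filter, Finset.mem_range] at hm hmd
    exact H.even_gap (by omega) hm.2.1 hmd.2.1
  · rintro ⟨h0, h1⟩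
    simp only [hV, Finset.mem_filter, Finset.mem_range] at h0 h1
    exact H.not_both_ends (by simpa using h0.2.1) (by simpa using h0.2.2.1)
      (by simpa using h0.2.2.2) h1.2.1 h1.2.2.1 h1.2.2.2

end IsWindow

/-- The coefficients of the binary polynomial, extended periodically. -/
def binCoeff (P Q i : ℤ) : ℤ := (if P ∣ i then 1 else 0) - if i % Q % P = 1 then 1 else 0

/-- The number of points of the window starting at `z` which are `i` modulo `P * Q`, minus the
number of such points of its translate. -/
def windowDiff (h : ℕ) (P Q δ z i : ℤ) : ℤ :=
  ∑ m ∈ Finset.range (2 * h + 1),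
    ((if P * Q ∣ z + m * δ - i then 1 else 0) -
      if P * Q ∣ z + m * δ + (h + 1) * Q - i then 1 else 0)

lemma truncCoeff_sub {P Q i : ℤ} (h0 : 0 ≤ i) (h1 : i < P * Q) (z : ℤ) :
    truncCoeff P Q i z - truncCoeff P Q (i - 1) z =
      binCoeff P Q i * if P * Q ∣ z - i then 1 else 0 := by
  have h2 := Int.emod_nonneg z (by omega : P * Q ≠ 0)
  by_cases hd : P * Q ∣ z - i
  · have hz : z % (P * Q) = i := by
      rw [Int.emod_eq_emod_iff_emod_sub_eq_zero.2 (Int.emod_eq_zero_of_dvd hd),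
        Int.emod_eq_of_lt h0 h1]
    have hP : P ∣ z ↔ P ∣ i := by
      rw [← Int.dvd_iff_dvd_of_dvd_sub ((Dvd.intro _ rfl).trans hd)]
    have hQ : z % Q = i % Q :=
      Int.emod_eq_emod_iff_emod_sub_eq_zero.2 (Int.emod_eq_zero_of_dvd
        ((Dvd.intro_left _ rfl).trans hd))
    simp [truncCoeff, plusInd, minusInd, binCoeff, hz, hd, hP, hQ]
  · have hz : z % (P * Q) ≠ i := by
      rintro rfl
      exact hd (Int.dvd_self_sub_emod)
    have hz' : z % (P * Q) ≤ i ↔ z % (P * Q) ≤ i - 1 := by omega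
    simp [truncCoeff, plusInd, minusInd, hd, hz']

namespace IsWindow

variable {h : ℕ} {k P Q δ : ℤ}

lemma windowSum_sub {i : ℤ} (h0 : 0 ≤ i) (h1 : i < P * Q) (z : ℤ) :
    windowSum h P Q δ i z - windowSum h P Q δ (i - 1) z =
      binCoeff P Q i * windowDiff h P Q δ z i := by
  rw [windowSum, windowSum, windowDiff, ← Finset.sum_sub_distrib, Finset.mul_sum]
  refine Finset.sum_congr rfl fun m _ => ?_
  rw [mul_sub, ← truncCoeff_sub h0 h1, ← truncCoeff_sub h0 h1]
  ring

lemma windowSum_of_neg (H : IsWindow h k P Q δ) {N : ℤ} (hN : N < 0) (z : ℤ) :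
    windowSum h P Q δ N z = 0 := by
  have : ∀ w, truncCoeff P Q N w = 0 := fun w => by
    have := Int.emod_nonneg w (mul_pos H.P_pos H.Q_pos).ne'
    have h2 : ¬ w % (P * Q) ≤ N := by omega
    simp [truncCoeff, plusInd, minusInd, h2]
  simp [windowSum, this]

lemma windowSum_eq_sum (H : IsWindow h k P Q δ) {N : ℕ} (hN : (N : ℤ) ≤ P * Q) (z : ℤ) :
    windowSum h P Q δ (N - 1) z =
      ∑ i ∈ Finset.range N, binCoeff P Q i * windowDiff h P Q δ z i := by
  induction N with
  | zero => simpa using H.windowSum_of_neg (by norm_num) z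
  | succ n ih =>
    push_cast at hN
    rw [Finset.sum_range_succ, ← ih (by omega),
      ← windowSum_sub (δ := δ) (h := h) (by positivity) (by omega)]
    push_cast
    ring_nf

/-- Once the truncation is void the window sums vanish. -/
lemma windowSum_of_le (H : IsWindow h k P Q δ) {N : ℤ} (hN : P * Q ≤ N + 1) (z : ℤ) :
    windowSum h P Q δ N z = 0 := by
  have hlt : ∀ w, w % (P * Q) ≤ N := fun w => by
    have := Int.emod_lt_of_pos w (mul_pos H.P_pos H.Q_pos)
    omega
  have hP := H.P_pos
  have hv : ∀ y, ∑ m ∈ Finset.range (2 * h + 1), plusInd P Q N (y + m * δ) = 1 := fun y => by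
    rw [H.sum_plusInd N y _ (Int.emod_nonneg (-(2 * y)) hP.ne') (Int.emod_lt_of_pos _ hP)
      (Int.dvd_of_emod_eq_zero (by rw [Int.add_emod_emod, add_neg_cancel, Int.zero_emod])),
      if_pos (hlt _)]
  rw [windowSum_eq, hv, hv, sub_self, zero_add]
  refine Finset.sum_eq_zero fun m _ => ?_
  simp only [minusInd, Int.add_mul_emod_self_right, hlt, sub_self]

lemma abs_windowDiff_le (H : IsWindow h k P Q δ) (z i : ℤ) : |windowDiff h P Q δ z i| ≤ 1 := by
  have hpl : ∀ w, (if P * Q ∣ w then (1 : ℤ) else 0) = plusInd P Q 0 w := fun w => by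
    rw [plusInd]
    refine if_congr ⟨fun hd => ⟨(Dvd.intro _ rfl).trans hd, (Int.emod_eq_zero_of_dvd hd).le⟩,
      fun hd => ?_⟩ rfl rfl
    exact Int.dvd_of_emod_eq_zero (le_antisymm hd.2
      (Int.emod_nonneg _ (mul_pos H.P_pos H.Q_pos).ne'))
  have e : windowDiff h P Q δ z i =
      ∑ m ∈ Finset.range (2 * h + 1), plusInd P Q 0 (z - i + m * δ) -
      ∑ m ∈ Finset.range (2 * h + 1), plusInd P Q 0 (z + (h + 1) * Q - i + m * δ) := by
    rw [windowDiff, ← Finset.sum_sub_distrib]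
    refine Finset.sum_congr rfl fun m _ => ?_
    rw [hpl, hpl]
    ring_nf
  have h1 := H.sum_plusInd_mem 0 (z - i)
  have h2 := H.sum_plusInd_mem 0 (z + (h + 1) * Q - i)
  rw [e, abs_le]
  constructor <;> linarith [h1.1, h1.2, h2.1, h2.2]

lemma abs_windowSum_sub_le (H : IsWindow h k P Q δ) (N z : ℤ) :
    |windowSum h P Q δ N z - windowSum h P Q δ (N - 1) z| ≤ 1 := by
  rcases lt_or_ge N 0 with hN | hN
  · rw [H.windowSum_of_neg hN, H.windowSum_of_neg (by omega)]
    simp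
  rcases lt_or_ge N (P * Q) with hN' | hN'
  · rw [windowSum_sub hN hN', abs_mul]
    have h1 : |binCoeff P Q N| ≤ 1 := by
      rw [binCoeff]
      split_ifs <;> simp
    nlinarith [H.abs_windowDiff_le z N, abs_nonneg (binCoeff P Q N),
      abs_nonneg (windowDiff h P Q δ z N)]
  · rw [H.windowSum_of_le (by omega), H.windowSum_of_le (by omega)]
    simp

end IsWindow

/-- A sequence of integers with steps at most `1` takes all intermediate values. -/
lemma exists_eq_of_abs_sub_le {f : ℕ → ℤ} (hf : ∀ n, |f (n + 1) - f n| ≤ 1) {N : ℕ} {v : ℤ}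
    (h0 : f 0 ≤ v) (hN : v ≤ f N) : ∃ n ≤ N, f n = v := by
  induction N with
  | zero => exact ⟨0, le_rfl, le_antisymm h0 hN⟩
  | succ n ih =>
    rcases le_or_gt v (f n) with h | h
    · obtain ⟨m, hm, hv⟩ := ih h
      exact ⟨m, hm.trans (Nat.le_succ n), hv⟩
    · have := abs_le.1 (hf n)
      exact ⟨n + 1, le_rfl, by omega⟩

lemma sum_range_two_mul_add_one {M : Type*} [AddCommMonoid M] (g : ℕ → M) (h : ℕ) :
    ∑ m ∈ Finset.range (2 * h + 1), g m =
      ∑ l ∈ Finset.range (h + 1), g (2 * l) + ∑ l ∈ Finset.range h, g (2 * l + 1) := by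
  induction h with
  | zero => simp
  | succ n ih =>
    rw [show 2 * (n + 1) + 1 = 2 * n + 1 + 1 + 1 by ring, Finset.sum_range_succ,
      Finset.sum_range_succ, ih, Finset.sum_range_succ (fun l => g (2 * l)) (n + 1),
      Finset.sum_range_succ (fun l => g (2 * l + 1)) n, show 2 * (n + 1) = 2 * n + 1 + 1 by ring]
    abel

namespace IsWindow

variable {h : ℕ} {k P Q δ : ℤ}

lemma le_windowSum_top (H : IsWindow h k P Q δ) :
    (h : ℤ) + 1 ≤ windowSum h P Q δ ((h - 1) * Q + 1 + k * P - h)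
      ((h - 1) * Q + 1 + k * P - h) := by
  have hP := H.hP
  have hPp := H.P_pos
  have hQp := H.Q_pos
  have hQ := H.hQ
  have hk := H.lt_k
  have hδ := H.hδ
  have hδ2 := H.two_δ
  have hadd := H.add_lt
  have h1 : (1 : ℤ) ≤ h := by exact_mod_cast H.one_le
  have hhQ : 0 ≤ ((h : ℤ) - 1) * Q := mul_nonneg (by omega) hQp.le
  have hhP : 0 ≤ (h : ℤ) * P := by positivity
  have hkP : (h + 1) * P ≤ k * P := by gcongr; omega
  have hPQe : P * Q = (h - 1) * Q + (h + 2) * Q := by rw [hP]; ring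
  have hhQ2 : 0 ≤ (h : ℤ) * Q := by positivity
  set z := ((h : ℤ) - 1) * Q + 1 + k * P - h with hz
  rw [windowSum_eq, H.sum_plusInd z z 0 le_rfl hPp ⟨2 * k * (2 * h - 1), by rw [hz, hQ]; ring⟩,
    H.sum_plusInd z (z + (h + 1) * Q) (2 * h) (by omega) (by omega)
      ⟨2 * (k * (2 * h - 1)) + 4 * k * (h + 1) + 2, by rw [hz, hQ, hP]; ring⟩]
  have e1 : (z + 0 * δ) % (P * Q) = z := by
    rw [zero_mul, add_zero, Int.emod_eq_of_lt] <;> nlinarith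
  have e2 : (z + (h + 1) * Q + 2 * h * δ) % (P * Q) = z + h * P := by
    rw [show z + (h + 1) * Q + 2 * h * δ = z + h * P + P * Q by
      linear_combination h * hδ2 - Q * hP, Int.add_emod_right, Int.emod_eq_of_lt] <;> nlinarith
  rw [e1, e2, if_pos le_rfl, if_neg (by nlinarith), sum_range_two_mul_add_one,
    Finset.sum_eq_zero (s := Finset.range (h + 1)), Finset.sum_congr rfl (g := fun _ => (1 : ℤ))]
  · simp [add_comm]
  · intro l hl
    have hl := Finset.mem_range.1 hl
    have hlP : ((l : ℤ) + 1) * P ≤ h * P := by gcongr; omega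
    have hlQ : ((l : ℤ) + 1) * Q ≤ h * Q := by gcongr; omega
    have hlP0 : 0 ≤ (l : ℤ) * P := by positivity
    have hlQ0 : 0 ≤ (l : ℤ) * Q := by positivity
    have f1 : z + (2 * l + 1 : ℕ) * δ = 1 + l * P + (h + l) * Q := by
      rw [hz]; push_cast
      linear_combination l * hδ2 + hδ - hQ
    have f2 : z + (2 * l + 1 : ℕ) * δ + (h + 1) * Q = 1 + l * P + l * Q + P * Q := by
      rw [f1, hP]; ring
    have f3 : (1 + l * P) % Q % P = 1 := by
      rw [Int.emod_eq_of_lt (b := Q) (by linarith) (by linarith), Int.add_mul_emod_self_right,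
        Int.emod_eq_of_lt] <;> omega
    rw [minusInd, minusInd, f2, f1, Int.add_emod_right, if_pos, if_neg, sub_zero]
    · rw [add_mul_emod_mul hPp (by linarith) (by linarith), Int.emod_eq_of_lt (a := h + l)
        (by omega) (by omega)]
      rintro ⟨-, hle⟩
      nlinarith
    · rw [mul_comm P Q, Int.add_mul_emod_self_left, Int.add_mul_emod_self_right, mul_comm Q P]
      refine ⟨f3, ?_⟩
      rw [Int.emod_eq_of_lt] <;> nlinarith
  · intro l hl
    have hl := Finset.mem_range.1 hl
    have hlP : (l : ℤ) * P ≤ h * P := by gcongr; omega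
    have hlP0 : 0 ≤ (l : ℤ) * P := by positivity
    have f1 : z + (2 * l : ℕ) * δ = (1 - h + (k + l) * P) + (h - 1 + l) * Q := by
      rw [hz]; push_cast
      linear_combination l * hδ2
    have f3 : (z + (2 * l : ℕ) * δ) % Q % P ≠ 1 := by
      rw [f1, Int.add_mul_emod_self_right, Int.emod_eq_of_lt (b := Q) (by nlinarith) (by nlinarith),
        Int.add_mul_emod_self_right]
      intro hc
      have := Int.dvd_self_sub_of_emod_eq hc
      have := Int.eq_zero_of_abs_lt_dvd this (abs_lt.2 ⟨by omega, by omega⟩)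
      omega
    simp only [minusInd, Int.add_mul_emod_self_right, f3, false_and, if_false, sub_self]

lemma windowSum_bottom_le (H : IsWindow h k P Q δ) :
    windowSum h P Q δ (h * Q - 1) (1 - Q) ≤ -h := by
  have hP := H.hP
  have hPp := H.P_pos
  have hQp := H.Q_pos
  have hQ := H.hQ
  have hk := H.lt_k
  have hδ := H.hδ
  have hδ2 := H.two_δ
  have hadd := H.add_lt
  have hlt := H.P_lt
  have h1 : (1 : ℤ) ≤ h := by exact_mod_cast H.one_le
  have hhQ : 0 ≤ ((h : ℤ) - 1) * Q := mul_nonneg (by omega) hQp.le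
  have hPQe : P * Q = 2 * (h * Q) + Q := by rw [hP]; ring
  rw [windowSum_eq, H.sum_plusInd _ (1 - Q) 0 le_rfl hPp ⟨-4 * k, by rw [hQ]; ring⟩]
  have e1 : (1 - Q + 0 * δ) % (P * Q) = 1 - Q + P * Q := by
    rw [zero_mul, add_zero, ← Int.add_emod_right, Int.emod_eq_of_lt] <;> nlinarith
  have e2 := (H.sum_plusInd_mem (h * Q - 1) (1 - Q + (h + 1) * Q)).1
  have f2 : ∀ l : ℕ, 1 - Q + (2 * l : ℕ) * δ = 1 + l * P + (l - 1) * Q := fun l => by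
    push_cast
    linear_combination l * hδ2
  have hminus : ∀ l : ℕ, l ≤ h → minusInd P Q (h * Q - 1)
      (1 - Q + (2 * l : ℕ) * δ + (h + 1) * Q) = 0 := by
    intro l hl
    have hlP : (l : ℤ) * P ≤ h * P := by gcongr
    have hlP0 : 0 ≤ (l : ℤ) * P := by positivity
    have hlQ0 : 0 ≤ (l : ℤ) * Q := by positivity
    rw [minusInd, if_neg]
    rintro ⟨-, hle⟩
    rw [f2, show 1 + l * P + (l - 1) * Q + (h + 1) * Q = 1 + l * P + (l + h) * Q by ring,
      add_mul_emod_mul hPp (by linarith) (by linarith), Int.emod_eq_of_lt (a := l + h)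
        (by omega) (by omega)] at hle
    linarith
  generalize ∑ m ∈ Finset.range (2 * h + 1),
    plusInd P Q (h * Q - 1) (1 - Q + (h + 1) * Q + m * δ) = s at e2 ⊢
  rw [e1, if_neg (by linarith), sum_range_two_mul_add_one,
    Finset.sum_eq_zero (s := Finset.range h), Finset.sum_range_succ',
    Finset.sum_congr rfl (g := fun _ => (-1 : ℤ)), hminus 0 (Nat.zero_le _)]
  · have e3 : minusInd P Q (h * Q - 1) (1 - Q + (2 * 0 : ℕ) * δ) = 0 := by
      rw [minusInd, if_neg]
      rintro ⟨-, hle⟩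
      rw [mul_zero, Nat.cast_zero, e1] at hle
      linarith
    rw [e3]
    simp only [Finset.sum_const, Finset.card_range, nsmul_eq_mul]
    linarith
  · intro l hl
    have hl := Finset.mem_range.1 hl
    have hlP : ((l : ℤ) + 1) * P ≤ h * P := by gcongr; omega
    have hlQ : ((l : ℤ) + 1) * Q ≤ h * Q := by gcongr; omega
    have hlP0 : 0 ≤ (l : ℤ) * P := by positivity
    have hlQ0 : 0 ≤ (l : ℤ) * Q := by positivity
    rw [hminus _ (by omega), f2, minusInd, if_pos, zero_sub]
    push_cast
    rw [add_sub_cancel_right, Int.add_mul_emod_self_right,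
      Int.emod_eq_of_lt (b := Q) (by nlinarith) (by nlinarith), Int.add_mul_emod_self_right,
      Int.emod_eq_of_lt (by omega) (by omega), Int.emod_eq_of_lt (by nlinarith) (by nlinarith)]
    exact ⟨rfl, by nlinarith⟩
  · intro l hl
    have hl := Finset.mem_range.1 hl
    have hlP : ((l : ℤ) + 1) * P ≤ h * P := by gcongr; omega
    have hlP0 : 0 ≤ (l : ℤ) * P := by positivity
    have f1 : 1 - Q + (2 * l + 1 : ℕ) * δ = (h + 2 + (k + l) * P) + (l - 1) * Q := by
      push_cast
      linear_combination l * hδ2 + hδ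
    have f3 : (1 - Q + (2 * l + 1 : ℕ) * δ) % Q % P ≠ 1 := by
      rw [f1, Int.add_mul_emod_self_right, Int.emod_eq_of_lt (b := Q) (by nlinarith) (by nlinarith),
        Int.add_mul_emod_self_right]
      intro hc
      have := Int.dvd_self_sub_of_emod_eq hc
      have := Int.eq_zero_of_abs_lt_dvd this (abs_lt.2 ⟨by omega, by omega⟩)
      omega
    simp only [minusInd, Int.add_mul_emod_self_right, f3, false_and, if_false, sub_self]

lemma windowSum_zero (H : IsWindow h k P Q δ) : windowSum h P Q δ 0 (1 - Q) = 0 := by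
  have hP := H.hP
  have hPp := H.P_pos
  have hQp := H.Q_pos
  have hδ2 := H.two_δ
  have hadd := H.add_lt
  have hlt := H.P_lt
  have key : ∀ m ≤ 2 * h, ¬ Q ∣ 1 + (m : ℤ) * δ := by
    intro m hm hd
    obtain ⟨l, rfl | rfl⟩ := Nat.even_or_odd' m
    · have hlP : (l : ℤ) * P ≤ h * P := by gcongr; omega
      have hlP0 : 0 ≤ (l : ℤ) * P := by positivity
      have e : 1 + (2 * l : ℕ) * δ = 1 + l * P + l * Q := by
        push_cast; linear_combination l * hδ2
      rw [e, Int.dvd_add_left (Dvd.intro_left _ rfl)] at hd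
      have := Int.eq_zero_of_abs_lt_dvd hd (abs_lt.2 ⟨by omega, by omega⟩)
      omega
    · have hlP : ((l : ℤ) + 1) * P ≤ h * P := by gcongr; omega
      have hlP0 : 0 ≤ (l : ℤ) * P := by positivity
      have e : 1 + (2 * l + 1 : ℕ) * δ = 1 + δ + l * P + l * Q := by
        push_cast; linear_combination l * hδ2
      rw [e, Int.dvd_add_left (Dvd.intro_left _ rfl)] at hd
      have := Int.eq_zero_of_abs_lt_dvd hd (abs_lt.2 ⟨by nlinarith, by nlinarith⟩)
      nlinarith
  have hz : windowDiff h P Q δ (1 - Q) 0 = 0 := by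
    refine Finset.sum_eq_zero fun m hm => ?_
    have hm := Finset.mem_range.1 hm
    have h1 := key m (by omega)
    rw [if_neg, if_neg, sub_zero]
    · intro hd
      refine h1 ((Int.dvd_add_left (Dvd.intro_left (h : ℤ) rfl)).1 ((Dvd.intro_left P rfl).trans
        (hd.trans (dvd_of_eq (?_ : _ = 1 + (m : ℤ) * δ + h * Q)))))
      ring
    · intro hd
      refine h1 ((Int.dvd_add_left (Dvd.intro_left (-1 : ℤ) rfl)).1 ((Dvd.intro_left P rfl).trans
        (hd.trans (dvd_of_eq (?_ : _ = 1 + (m : ℤ) * δ + -1 * Q)))))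
      ring
  have h1 := windowSum_sub (δ := δ) (h := h) le_rfl (mul_pos hPp hQp) (1 - Q)
  rwa [hz, mul_zero, H.windowSum_of_neg (N := 0 - 1) (by norm_num), sub_zero] at h1

lemma exists_windowSum_eq (H : IsWindow h k P Q δ) {v : ℤ} (hv : -(h : ℤ) ≤ v)
    (hv' : v ≤ h + 1) : ∃ N : ℕ, ∃ z : ℤ, (N : ℤ) + 1 ≤ h * Q ∧ windowSum h P Q δ N z = v := by
  have hQp := H.Q_pos
  have h1 : (1 : ℤ) ≤ h := by exact_mod_cast H.one_le
  have hhQ : 0 ≤ ((h : ℤ) - 1) * Q := mul_nonneg (by omega) hQp.le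
  have habs : ∀ z : ℤ, |windowSum h P Q δ 0 z| ≤ 1 := fun z => by
    have := H.abs_windowSum_sub_le 0 z
    rwa [H.windowSum_of_neg (N := 0 - 1) (by norm_num), sub_zero] at this
  have hstep : ∀ (z : ℤ) (n : ℕ), |windowSum h P Q δ (n + 1 : ℕ) z - windowSum h P Q δ n z| ≤ 1 :=
    fun z n => by
      have := H.abs_windowSum_sub_le (n + 1) z
      rwa [add_sub_cancel_right] at this
  rcases lt_trichotomy v 0 with hneg | rfl | hpos
  · obtain ⟨N, hN⟩ : ∃ N : ℕ, (N : ℤ) = h * Q - 1 := ⟨(h * Q - 1).toNat, by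
      rw [Int.toNat_of_nonneg]; nlinarith⟩
    have h3 := H.windowSum_bottom_le
    rw [← hN] at h3
    obtain ⟨n, hn, hv⟩ := exists_eq_of_abs_sub_le
      (f := fun n : ℕ => - windowSum h P Q δ n (1 - Q)) (N := N) (v := -v)
      (fun n => by
        have := hstep (1 - Q) n
        rwa [← abs_neg, neg_sub'] at this)
      (by have := abs_le.1 (habs (1 - Q)); simp only [Nat.cast_zero]; omega) (by omega)
    exact ⟨n, 1 - Q, by omega, neg_injective hv⟩
  · exact ⟨0, 1 - Q, by push_cast; nlinarith, H.windowSum_zero⟩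
  · have hkP : (h + 1) * P ≤ k * P := by gcongr; exacts [H.P_pos.le, H.lt_k]
    have hPp := H.P_pos
    have h3 := H.le_windowSum_top
    have hQ := H.hQ
    obtain ⟨N, hN⟩ : ∃ N : ℕ, (N : ℤ) = (h - 1) * Q + 1 + k * P - h :=
      ⟨((h - 1) * Q + 1 + k * P - h).toNat, by rw [Int.toNat_of_nonneg]; nlinarith⟩
    rw [← hN] at h3
    obtain ⟨n, hn, hv⟩ := exists_eq_of_abs_sub_le
      (f := fun n : ℕ => windowSum h P Q δ n ((h - 1) * Q + 1 + k * P - h)) (N := N) (v := v)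
      (fun n => hstep _ n)
      (by have := abs_le.1 (habs ((h - 1) * Q + 1 + k * P - h)); simp only [Nat.cast_zero]; omega)
      (by rw [← hN]; omega)
    exact ⟨n, _, by nlinarith, hv⟩

end IsWindow

lemma sum_range_mul {M : Type*} [AddCommMonoid M] (f : ℕ → M) (a b : ℕ) :
    ∑ i ∈ Finset.range (a * b), f i =
      ∑ y ∈ Finset.range a, ∑ j ∈ Finset.range b, f (y * b + j) := by
  induction a with
  | zero => simp
  | succ n ih => rw [Nat.succ_mul, Finset.sum_range_add, ih, Finset.sum_range_succ]

lemma PowerSeries.mk_dvd_mul_one_sub_X_pow {M : ℕ} (hM : 0 < M) :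
    (PowerSeries.mk fun j => if M ∣ j then (1 : ℤ) else 0) * (1 - PowerSeries.X ^ M) = 1 := by
  ext n
  rw [mul_sub, mul_one, mul_comm, map_sub, PowerSeries.coeff_mk, PowerSeries.coeff_X_pow_mul',
    PowerSeries.coeff_one]
  simp only [PowerSeries.coeff_mk]
  by_cases hn : M ≤ n
  · rw [if_pos hn, if_neg (by omega : n ≠ 0), sub_eq_zero]
    exact if_congr (Nat.dvd_sub_iff_left hn dvd_rfl).symm rfl rfl
  · rw [if_neg hn, sub_zero]
    refine if_congr ⟨fun hd => ?_, fun hd => hd ▸ dvd_zero M⟩ rfl rfl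
    exact Nat.eq_zero_of_dvd_of_lt hd (by omega)

lemma sum_dvd_mul_pow {A : Type*} [CommRing A] (x : A) {P : ℕ} (hP : 0 < P) (Q : ℕ) :
    (∑ i ∈ Finset.range (P * Q), (if P ∣ i then 1 else 0) * x ^ i) * (x ^ P - 1) =
      x ^ (P * Q) - 1 := by
  have : ∑ i ∈ Finset.range (P * Q), (if P ∣ i then 1 else 0) * x ^ i =
      ∑ y ∈ Finset.range Q, (x ^ P) ^ y := by
    rw [mul_comm P, sum_range_mul]
    refine Finset.sum_congr rfl fun y _ => ?_
    rw [Finset.sum_eq_single 0]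
    · simp [pow_mul']
    · intro j hj hj0
      rw [if_neg, zero_mul]
      intro hd
      rw [Nat.dvd_add_right (Dvd.intro_left _ rfl)] at hd
      exact hj0 (Nat.eq_zero_of_dvd_of_lt hd (Finset.mem_range.1 hj))
    · exact fun hn => absurd (Finset.mem_range.2 hP) hn
  rw [this, geom_sum_mul, ← pow_mul]

lemma sum_mod_mul_pow {A : Type*} [CommRing A] (x : A) {P : ℕ} (hP : 1 < P) (u : ℕ) :
    (∑ i ∈ Finset.range (P * (u * P + 1)), (if i % (u * P + 1) % P = 1 then 1 else 0) * x ^ i) *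
      ((x ^ P - 1) * (x ^ (u * P + 1) - 1)) =
      x * (x ^ (u * P) - 1) * (x ^ (P * (u * P + 1)) - 1) := by
  have h1 : ∀ w : ℕ, ∑ j ∈ Finset.range P, (if j % P = 1 then 1 else 0) * x ^ (w + j) =
      x ^ (w + 1) := fun w => by
    rw [Finset.sum_eq_single 1]
    · simp [Nat.mod_eq_of_lt hP]
    · intro j hj hj1
      rw [Nat.mod_eq_of_lt (Finset.mem_range.1 hj), if_neg hj1, zero_mul]
    · exact fun hn => absurd (Finset.mem_range.2 hP) hn
  have h2 : ∑ i ∈ Finset.range (P * (u * P + 1)),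
      (if i % (u * P + 1) % P = 1 then 1 else 0) * x ^ i =
      (∑ y ∈ Finset.range P, (x ^ (u * P + 1)) ^ y) * (x * ∑ t ∈ Finset.range u, (x ^ P) ^ t) := by
    rw [sum_range_mul, Finset.sum_mul]
    refine Finset.sum_congr rfl fun y _ => ?_
    rw [Finset.sum_range_succ, Nat.mul_add_mod_of_lt (by omega), Nat.mul_mod_left, if_neg (by omega),
      zero_mul, add_zero, sum_range_mul, Finset.mul_sum, Finset.mul_sum]
    refine Finset.sum_congr rfl fun t ht => ?_
    rw [← pow_mul, ← pow_mul, ← pow_succ', ← pow_add]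
    convert h1 (y * (u * P + 1) + t * P) using 2 with j hj
    · have hj := Finset.mem_range.1 hj
      have : (t + 1) * P ≤ u * P := Nat.mul_le_mul_right P (Finset.mem_range.1 ht)
      rw [Nat.mul_add_mod_of_lt (by rw [add_mul] at this; omega), Nat.mul_add_mod_self_right,
        Nat.mod_eq_of_lt hj, add_assoc]
    · ring
  rw [h2]
  linear_combination (x * ((∑ t ∈ Finset.range u, (x ^ P) ^ t) * (x ^ P - 1))) *
    geom_sum_mul (x ^ (u * P + 1)) P + x * ((x ^ (u * P + 1)) ^ P - 1) * geom_sum_mul (x ^ P) u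

namespace IsWindow

variable {h P Q R : ℕ} {k δ : ℤ}

lemma sum_binCoeff_mul_pow (H : IsWindow h k P Q δ) {A : Type*} [CommRing A] (x : A) :
    (∑ i ∈ Finset.range (P * Q), (binCoeff P Q i : A) * x ^ i) * ((x ^ P - 1) * (x ^ Q - 1)) =
      (x ^ (P * Q) - 1) * (x - 1) := by
  have hP := H.hP
  have h1 := H.one_le
  obtain ⟨u, hu⟩ : ∃ u : ℕ, (u : ℤ) = 2 * k := ⟨(2 * k).toNat, by have := H.lt_k; omega⟩
  obtain rfl : Q = u * P + 1 := by
    have := H.hQ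
    rw [← hu, add_comm] at this
    exact_mod_cast this
  have e : ∀ i : ℕ, (binCoeff P (u * P + 1 : ℕ) i : A) = (if P ∣ i then 1 else 0) -
      if i % (u * P + 1) % P = 1 then 1 else 0 := fun i => by
    have h2 : (i : ℤ) % (u * P + 1 : ℕ) % P = 1 ↔ i % (u * P + 1) % P = 1 := by norm_cast
    rw [binCoeff, if_congr Int.natCast_dvd_natCast rfl rfl, if_congr h2 rfl rfl]
    push_cast
    rfl
  simp only [e, sub_mul (ite _ _ _), Finset.sum_sub_distrib]
  rw [sub_mul, sum_mod_mul_pow x (by omega), ← mul_assoc, sum_dvd_mul_pow x (by omega)]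
  ring

end IsWindow

/-- The power series expansion of the ternary inclusion-exclusion polynomial. -/
noncomputable def ternarySeries (P Q R : ℕ) : PowerSeries ℤ :=
  (∑ i ∈ Finset.range (P * Q), (binCoeff P Q i : PowerSeries ℤ) * (PowerSeries.X ^ R) ^ i) *
    ((∑ m ∈ Finset.range P, PowerSeries.X ^ m) * (1 - PowerSeries.X ^ Q)) *
    PowerSeries.mk fun j => if P * Q ∣ j then (1 : ℤ) else 0

namespace IsWindow

variable {h P Q R : ℕ} {k δ : ℤ}

lemma ternarySeries_mul (H : IsWindow h k P Q δ) :
    ternarySeries P Q R * ((PowerSeries.X ^ (P * Q) - 1) * (PowerSeries.X ^ (Q * R) - 1) *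
      (PowerSeries.X ^ (R * P) - 1) * (PowerSeries.X - 1)) =
    (PowerSeries.X ^ (P * Q * R) - 1) * (PowerSeries.X ^ P - 1) * (PowerSeries.X ^ Q - 1) *
      (PowerSeries.X ^ R - 1) := by
  have h1 := H.sum_binCoeff_mul_pow (PowerSeries.X ^ R : PowerSeries ℤ)
  have h2 := PowerSeries.mk_dvd_mul_one_sub_X_pow (M := P * Q) (by
    exact_mod_cast mul_pos H.P_pos H.Q_pos)
  have h3 := geom_sum_mul (PowerSeries.X : PowerSeries ℤ) P
  rw [← pow_mul, ← pow_mul, ← pow_mul] at h1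
  rw [ternarySeries, mul_comm Q R, mul_comm (P * Q) R]
  generalize (PowerSeries.mk fun j => if P * Q ∣ j then (1 : ℤ) else 0) = I at h2 ⊢
  generalize ∑ i ∈ Finset.range (P * Q),
    (binCoeff P Q i : PowerSeries ℤ) * (PowerSeries.X ^ R) ^ i = U at h1 ⊢
  generalize ∑ m ∈ Finset.range P, (PowerSeries.X : PowerSeries ℤ) ^ m = B at h3 ⊢
  linear_combination (PowerSeries.X ^ P - 1) * (PowerSeries.X ^ Q - 1) * h1 +
    U * (PowerSeries.X ^ (R * P) - 1) * (PowerSeries.X ^ (R * Q) - 1) * (PowerSeries.X ^ Q - 1) *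
      (h3 + B * (PowerSeries.X - 1) * h2)

lemma coeff_X_pow_mul_mk_dvd {M : ℕ} {d n : ℕ} (hd : d < n + M) :
    PowerSeries.coeff n (PowerSeries.X ^ d *
      PowerSeries.mk fun j => if M ∣ j then (1 : ℤ) else 0) =
      if (M : ℤ) ∣ (n : ℤ) - d then 1 else 0 := by
  rw [PowerSeries.coeff_X_pow_mul']
  split_ifs with h1 h2 h2
  · rw [PowerSeries.coeff_mk, if_pos]
    rwa [← Nat.cast_sub h1, Int.natCast_dvd_natCast] at h2
  · rw [PowerSeries.coeff_mk, if_neg]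
    rwa [← Nat.cast_sub h1, Int.natCast_dvd_natCast] at h2
  · have := Int.eq_zero_of_abs_lt_dvd h2 (abs_lt.2 ⟨by omega, by omega⟩)
    omega
  · rfl

lemma windowSum_congr {h : ℕ} {P Q δ N z z' : ℤ} (hz : P * Q ∣ z - z') :
    windowSum h P Q δ N z = windowSum h P Q δ N z' := by
  have key : ∀ w w' : ℤ, P * Q ∣ w - w' → truncCoeff P Q N w = truncCoeff P Q N w' := by
    intro w w' hd
    have e1 : w % (P * Q) = w' % (P * Q) :=
      Int.emod_eq_emod_iff_emod_sub_eq_zero.2 (Int.emod_eq_zero_of_dvd hd)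
    have e2 : w % Q = w' % Q :=
      Int.emod_eq_emod_iff_emod_sub_eq_zero.2 (Int.emod_eq_zero_of_dvd
        ((Dvd.intro_left _ rfl).trans hd))
    have e3 : P ∣ w ↔ P ∣ w' := Int.dvd_iff_dvd_of_dvd_sub ((Dvd.intro _ rfl).trans hd)
    simp only [truncCoeff, plusInd, minusInd, e1, e2, e3]
  refine Finset.sum_congr rfl fun m _ => ?_
  rw [key (z + m * δ) (z' + m * δ) (by rwa [add_sub_add_right_eq_sub]),
    key (z + m * δ + (h + 1) * Q) (z' + m * δ + (h + 1) * Q)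
      (by rwa [add_sub_add_right_eq_sub, add_sub_add_right_eq_sub])]

lemma dvd_sub_mul_iff {M R δ : ℤ} (hR : M ∣ R * δ + 1) (n i m : ℤ) :
    M ∣ n - (R * i + m) ↔ M ∣ -(δ * n) + m * δ - i := by
  have e : -(δ * n) + m * δ - i = -δ * (n - (R * i + m)) - (R * δ + 1) * i := by ring
  have e' : n - (R * i + m) = R * (-(δ * n) + m * δ - i) + (R * δ + 1) * (n - m) := by ring
  constructor
  · intro hd
    rw [e]
    exact (hd.mul_left _).sub (hR.mul_right _)
  · intro hd
    rw [e']
    exact (hd.mul_left _).add (hR.mul_right _)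

lemma coeff_ternarySeries (H : IsWindow h k P Q δ) (hR : (P * Q : ℤ) ∣ R * δ + 1) (hR0 : 0 < R)
    (n : ℕ) : PowerSeries.coeff n (ternarySeries P Q R) =
      windowSum h P Q δ (n / R : ℕ) (-(δ * n)) := by
  have hPQ := H.P_lt
  have hP := H.hP
  have h1 := H.one_le
  have hPQle : P + Q ≤ P * Q := by nlinarith
  have hδ : (P * Q : ℤ) ∣ Q * δ - (h + 1) * Q := by
    rw [show (Q * δ - (h + 1) * Q : ℤ) = (δ - (h + 1)) * Q by ring]
    exact mul_dvd_mul_right H.dvd_δ_sub _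
  have step : ∀ i : ℕ, i ≤ n / R → PowerSeries.coeff n ((PowerSeries.X ^ R) ^ i *
      ((∑ m ∈ Finset.range P, PowerSeries.X ^ m) * (1 - PowerSeries.X ^ Q)) *
      PowerSeries.mk fun j => if P * Q ∣ j then (1 : ℤ) else 0) =
      windowDiff h P Q δ (-(δ * n)) i := by
    intro i hi
    have hi' : R * i ≤ n := by rw [mul_comm]; exact (Nat.le_div_iff_mul_le hR0).1 hi
    obtain rfl : P = 2 * h + 1 := by exact_mod_cast hP
    rw [windowDiff, ← pow_mul, Finset.sum_mul, Finset.mul_sum, Finset.sum_mul, map_sum]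
    refine Finset.sum_congr rfl fun m hm => ?_
    have hm := Finset.mem_range.1 hm
    rw [mul_sub, mul_one, ← pow_add, mul_sub, ← pow_add, ← pow_add, sub_mul, map_sub,
      coeff_X_pow_mul_mk_dvd (by omega), coeff_X_pow_mul_mk_dvd (by omega)]
    congr 1
    · refine if_congr ?_ rfl rfl
      have := dvd_sub_mul_iff hR n i m
      push_cast at this ⊢
      exact this
    · refine if_congr ?_ rfl rfl
      have := dvd_sub_mul_iff hR n i (m + Q)
      push_cast at this ⊢ hδ
      rw [← add_assoc] at this
      rw [← add_assoc, this]
      refine Int.dvd_iff_dvd_of_dvd_sub ?_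
      convert hδ using 1
      ring
  have zero : ∀ i : ℕ, n / R < i → PowerSeries.coeff n ((PowerSeries.X ^ R) ^ i *
      ((∑ m ∈ Finset.range P, PowerSeries.X ^ m) * (1 - PowerSeries.X ^ Q)) *
      PowerSeries.mk fun j => if P * Q ∣ j then (1 : ℤ) else 0) = 0 := by
    intro i hi
    rw [← pow_mul, mul_assoc, PowerSeries.coeff_X_pow_mul', if_neg]
    rw [Nat.div_lt_iff_lt_mul hR0, mul_comm] at hi
    omega
  rw [ternarySeries, Finset.sum_mul, Finset.sum_mul, map_sum]
  have e : ∀ i : ℕ, PowerSeries.coeff n ((binCoeff P Q i : PowerSeries ℤ) * (PowerSeries.X ^ R) ^ i *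
      ((∑ m ∈ Finset.range P, PowerSeries.X ^ m) * (1 - PowerSeries.X ^ Q)) *
      PowerSeries.mk fun j => if P * Q ∣ j then (1 : ℤ) else 0) =
      binCoeff P Q i * if i ≤ n / R then windowDiff h P Q δ (-(δ * n)) i else 0 := by
    intro i
    rw [mul_assoc, mul_assoc, ← mul_assoc (_ ^ i), ← map_intCast (PowerSeries.C (R := ℤ)),
      PowerSeries.coeff_C_mul, Int.cast_id]
    split_ifs with hi
    · rw [step i hi]
    · rw [zero i (by omega)]
  simp only [e]
  by_cases hn : n / R < P * Q
  · have hs := H.windowSum_eq_sum (N := n / R + 1) (by exact_mod_cast hn) (-(δ * n))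
    rw [Nat.cast_succ, add_sub_cancel_right] at hs
    rw [hs, ← Finset.sum_subset (Finset.range_subset_range.2 hn)]
    · refine Finset.sum_congr rfl fun i hi => ?_
      rw [if_pos (Nat.lt_succ_iff.1 (Finset.mem_range.1 hi))]
    · intro i _ hi
      rw [Finset.mem_range, Nat.lt_succ_iff] at hi
      rw [if_neg hi, mul_zero]
  · have hs := H.windowSum_eq_sum (N := P * Q) (by push_cast; rfl) (-(δ * n))
    rw [H.windowSum_of_le (by push_cast; omega)] at hs
    rw [H.windowSum_of_le (by push_cast; norm_cast; omega), hs]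
    refine Finset.sum_congr rfl fun i hi => ?_
    have := Finset.mem_range.1 hi
    rw [if_pos (by omega)]

lemma coeff_Qpoly (H : IsWindow h k P Q δ) (hR : (P * Q : ℤ) ∣ R * δ + 1) (hR0 : 0 < R) (n : ℕ) :
    (Qpoly P Q R).coeff n = windowSum h P Q δ (n / R : ℕ) (-(δ * n)) := by
  have hP0 : P ≠ 0 := by have := H.P_pos; omega
  have hQ0 : Q ≠ 0 := by have := H.Q_pos; omega
  have hmon : ∀ d : ℕ, d ≠ 0 → (X ^ d - 1 : ℤ[X]).Monic := fun d hd => by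
    simpa using monic_X_pow_sub_C (1 : ℤ) hd
  obtain ⟨T, hT⟩ : ∃ T : ℤ[X], (T : PowerSeries ℤ) = ternarySeries P Q R := by
    refine ⟨(ternarySeries P Q R).trunc (P * Q * R), ?_⟩
    ext n
    rw [coeff_coe, PowerSeries.coeff_trunc]
    split_ifs with hn
    · rfl
    · rw [H.coeff_ternarySeries hR hR0, H.windowSum_of_le]
      rw [not_lt, ← Nat.le_div_iff_mul_le hR0] at hn
      norm_cast
      omega
  have hmul : ((X ^ (P * Q) - 1) * (X ^ (Q * R) - 1) * (X ^ (R * P) - 1) * (X - 1)) * T =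
      (X ^ (P * Q * R) - 1) * (X ^ P - 1) * (X ^ Q - 1) * (X ^ R - 1) := by
    apply coe_injective ℤ
    have := H.ternarySeries_mul (R := R)
    rw [← hT, mul_comm] at this
    simpa using this
  rw [Qpoly, ← hmul, mul_divByMonic_cancel_left, ← coeff_coe, hT, H.coeff_ternarySeries hR hR0]
  exact (((hmon _ (mul_ne_zero hP0 hQ0)).mul (hmon _ (mul_ne_zero hQ0 hR0.ne'))).mul
    (hmon _ (mul_ne_zero hR0.ne' hP0))).mul (by simpa using hmon 1 one_ne_zero)

theorem coeffSet_eq (H : IsWindow h k P Q δ) (hR : (P * Q : ℤ) ∣ R * δ + 1) (hPQR : P * Q ≤ R) :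
    coeffSet P Q R = {n : ℤ | -(h : ℤ) ≤ n ∧ n ≤ h + 1} := by
  have hP := H.hP
  have h1 := H.one_le
  have hlt : P < Q := by exact_mod_cast H.P_lt
  obtain rfl : P = 2 * h + 1 := by exact_mod_cast hP
  have hM : 0 < (2 * h + 1) * Q := Nat.mul_pos (by omega) (by omega)
  have hR0 : 0 < R := by omega
  ext v
  simp only [coeffSet, H.coeff_Qpoly hR hR0, Set.mem_ofPred_eq]
  constructor
  · rintro ⟨m, -, rfl⟩
    exact ⟨H.le_windowSum _ _, H.windowSum_le _ _⟩
  · rintro ⟨hv, hv'⟩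
    obtain ⟨N, z, hN, hNz⟩ := H.exists_windowSum_eq hv hv'
    have hM' : (0 : ℤ) < (2 * h + 1 : ℕ) * Q := by exact_mod_cast hM
    have s0 := Int.emod_nonneg (R * z - N * R) hM'.ne'
    have s1 := Int.emod_lt_of_pos (R * z - N * R) hM'
    have s2 := Int.dvd_self_sub_emod (x := R * z - N * R) (m := (2 * h + 1 : ℕ) * Q)
    generalize (R * z - N * R) % ((2 * h + 1 : ℕ) * Q) = s at s0 s1 s2
    lift s to ℕ using s0
    have hsR : s < R := lt_of_lt_of_le (by exact_mod_cast s1) hPQR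
    refine ⟨N * R + s, ?_, ?_⟩
    · have hN' : N + 1 ≤ h * Q := by exact_mod_cast hN
      have : N * R + s < (N + 1) * R := by rw [Nat.succ_mul]; omega
      have h3 : (N + 1) * R ≤ h * Q * R := Nat.mul_le_mul_right R hN'
      have hQR : Q ≤ R := le_trans (Nat.le_mul_of_pos_left Q (by omega)) hPQR
      obtain ⟨Q', rfl⟩ : ∃ Q', Q = Q' + 4 := ⟨Q - 4, by omega⟩
      obtain ⟨R', rfl⟩ : ∃ R', R = R' + 4 := ⟨R - 4, by omega⟩
      have h4 : (Q' + 4) * (R' + 4) ≤ 2 * ((Q' + 3) * (R' + 3)) := by nlinarith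
      calc N * (R' + 4) + s ≤ h * ((Q' + 4) * (R' + 4)) := by rw [← mul_assoc]; omega
        _ ≤ h * (2 * ((Q' + 3) * (R' + 3))) := Nat.mul_le_mul_left h h4
        _ = _ := by
          simp only [Nat.add_sub_cancel, show Q' + 4 - 1 = Q' + 3 by omega,
            show R' + 4 - 1 = R' + 3 by omega]
          ring
    · rw [← hNz, mul_comm N R, Nat.mul_add_div hR0, Nat.div_eq_of_lt hsR, add_zero]
      apply windowSum_congr
      push_cast at hR s2 ⊢
      have e : -(δ * (R * N + s)) - z = δ * (R * z - N * R - s) - (R * δ + 1) * z := by ring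
      rw [e]
      exact (s2.mul_left _).sub (hR.mul_right _)

end IsWindow

namespace IsPrimRootMod

lemma orderOf_eq {g m : ℕ} [NeZero m] (hg : IsPrimRootMod g m) :
    orderOf (g : ZMod m) = m.totient := by
  obtain ⟨⟨u, hu⟩, hgen⟩ := hg
  rw [← hu, orderOf_units, ← ZMod.card_units_eq_totient, ← Nat.card_eq_fintype_card]
  refine orderOf_eq_card_of_forall_mem_zpowers fun x => ?_
  obtain ⟨i, hi⟩ := hgen x
  exact ⟨i, Units.ext (by simpa [hu] using hi)⟩

variable {p g : ℕ}

lemma mul_dvd_of_dvd_pow_sub_one (hp : p.Prime) (hg : IsPrimRootMod g (p ^ 2)) {i : ℕ}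
    (hi : (p : ℤ) ^ 2 ∣ (g : ℤ) ^ i - 1) : p * (p - 1) ∣ i := by
  have : NeZero (p ^ 2) := ⟨pow_ne_zero _ hp.ne_zero⟩
  have h1 : (g : ZMod (p ^ 2)) ^ i = 1 := by
    rw [← sub_eq_zero]
    have := (ZMod.intCast_zmod_eq_zero_iff_dvd ((g : ℤ) ^ i - 1) (p ^ 2)).2 (by exact_mod_cast hi)
    simpa using this
  have h2 := orderOf_dvd_of_pow_eq_one h1
  rw [hg.orderOf_eq, Nat.totient_prime_pow_succ hp, pow_one] at h2
  exact h2

lemma sub_one_dvd_of_dvd_pow_sub_one (hp : p.Prime) (hg : IsPrimRootMod g (p ^ 2)) {i : ℕ}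
    (hi : (p : ℤ) ∣ (g : ℤ) ^ i - 1) : p - 1 ∣ i := by
  have h1 := dvd_sub_pow_of_dvd_sub (p := p) hi 1
  rw [pow_one, one_pow, ← pow_mul] at h1
  have h2 := hg.mul_dvd_of_dvd_pow_sub_one hp h1
  rw [mul_comm i] at h2
  exact Nat.dvd_of_mul_dvd_mul_left hp.pos h2

lemma not_dvd (hp : p.Prime) (hg : IsPrimRootMod g (p ^ 2)) : ¬ p ∣ g := by
  intro hd
  have h1 := (ZMod.isUnit_iff_coprime _ _).1 hg.1
  have h2 := Nat.dvd_gcd hd (dvd_pow_self p two_ne_zero)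
  rw [h1] at h2
  exact hp.one_lt.ne' (Nat.dvd_one.1 h2)

lemma dvd_pow_sub_one (hp : p.Prime) (hg : IsPrimRootMod g (p ^ 2)) :
    (p : ℤ) ∣ (g : ℤ) ^ (p - 1) - 1 := by
  have := Int.ModEq.pow_card_sub_one_eq_one hp
    (Nat.isCoprime_iff_coprime.2 ((Nat.Prime.coprime_iff_not_dvd hp).2 (hg.not_dvd hp)).symm)
  exact this.symm.dvd

lemma legendreSym_eq (hp : p.Prime) [Fact p.Prime] (hp2 : p ≠ 2) (hg : IsPrimRootMod g (p ^ 2)) :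
    legendreSym p g = -1 := by
  have h0 : ((g : ℤ) : ZMod p) ≠ 0 := by
    rw [Int.cast_natCast, Ne, ZMod.natCast_eq_zero_iff]
    exact hg.not_dvd hp
  refine (legendreSym.eq_one_or_neg_one p h0).resolve_left fun h1 => ?_
  have h2 := legendreSym.eq_pow p g
  rw [h1] at h2
  have h3 : (p : ℤ) ∣ (g : ℤ) ^ (p / 2) - 1 := by
    rw [← ZMod.intCast_zmod_eq_zero_iff_dvd]
    push_cast at h2 ⊢
    rw [← h2, sub_self]
  have h4 := hp.two_le
  have h5 := Nat.le_of_dvd (by omega) (hg.sub_one_dvd_of_dvd_pow_sub_one hp h3)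
  omega

/-- A primitive root modulo `p ^ 2` is a primitive root modulo all powers of `p`. -/
lemma orderOf_pow (hp : p.Prime) (hp2 : p ≠ 2) (hg : IsPrimRootMod g (p ^ 2)) (n : ℕ) :
    p ^ n * (p - 1) ∣ orderOf (g : ZMod (p ^ (n + 1))) := by
  have h2 := hp.two_le
  refine Nat.Coprime.mul_dvd_of_dvd_of_dvd ?_ ?_ ?_
  · refine Nat.Coprime.pow_left n ((Nat.Prime.coprime_iff_not_dvd hp).2 fun hd => ?_)
    have := Nat.le_of_dvd (by omega) hd
    omega
  · obtain ⟨a, ha⟩ := hg.dvd_pow_sub_one hp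
    have hpa : ¬ (p : ℤ) ∣ a := by
      rintro ⟨b, rfl⟩
      have h3 := hg.mul_dvd_of_dvd_pow_sub_one hp (i := p - 1) ⟨b, by rw [ha]; ring⟩
      have h4 := Nat.le_of_dvd (by omega) h3
      have : 2 * (p - 1) ≤ p * (p - 1) := Nat.mul_le_mul_right _ h2
      omega
    have h3 := ZMod.orderOf_one_add_mul_prime hp hp2 a hpa n
    have h4 : (1 + p * a : ZMod (p ^ (n + 1))) = (g : ZMod (p ^ (n + 1))) ^ (p - 1) := by
      have : ((g : ℤ) ^ (p - 1)) = 1 + p * a := by linarith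
      exact_mod_cast (congrArg (Int.cast : ℤ → ZMod (p ^ (n + 1))) this).symm
    rw [← h3, h4]
    exact orderOf_pow_dvd _
  · refine hg.sub_one_dvd_of_dvd_pow_sub_one hp (dvd_trans (dvd_pow_self (p : ℤ) n.succ_ne_zero) ?_)
    have h3 := pow_orderOf_eq_one (g : ZMod (p ^ (n + 1)))
    have h4 := (ZMod.intCast_zmod_eq_zero_iff_dvd
      ((g : ℤ) ^ orderOf (g : ZMod (p ^ (n + 1))) - 1) (p ^ (n + 1))).1
      (by push_cast at h3 ⊢; rw [h3, sub_self])
    exact_mod_cast h4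

lemma exists_pow_eq (hp : p.Prime) (hp2 : p ≠ 2) (hg : IsPrimRootMod g (p ^ 2)) {n : ℕ}
    (hn : 0 < n) (x : (ZMod (p ^ n))ˣ) :
    ∃ i : ℕ, ∀ j, j ≡ i [MOD (p ^ n).totient] → (g : ZMod (p ^ n)) ^ j = x := by
  obtain ⟨n, rfl⟩ := Nat.exists_eq_succ_of_ne_zero hn.ne'
  have : NeZero (p ^ n.succ) := ⟨pow_ne_zero _ hp.ne_zero⟩
  obtain ⟨u, hu⟩ : IsUnit (g : ZMod (p ^ n.succ)) := by
    rw [ZMod.isUnit_iff_coprime]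
    exact ((Nat.Prime.coprime_iff_not_dvd hp).2 (hg.not_dvd hp)).symm.pow_right _
  have hord : orderOf u = (p ^ n.succ).totient := by
    refine Nat.dvd_antisymm ?_ ?_
    · rw [← ZMod.card_units_eq_totient]
      exact orderOf_dvd_card
    · rw [Nat.totient_prime_pow_succ hp, ← orderOf_units, hu]
      exact hg.orderOf_pow hp hp2 n
  have htop : Subgroup.zpowers u = ⊤ := by
    refine Subgroup.eq_top_of_card_eq _ ?_
    rw [Nat.card_zpowers, hord, Nat.card_eq_fintype_card, ZMod.card_units_eq_totient]
  obtain ⟨i, hi⟩ : x ∈ Submonoid.powers u :=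
    mem_powers_iff_mem_zpowers.2 (htop ▸ Subgroup.mem_top x)
  refine ⟨i, fun j hj => ?_⟩
  rw [← hu, ← hi, ← Units.val_pow_eq_pow_val, Units.val_inj]
  exact pow_eq_pow_iff_modEq.2 (hord ▸ hj)

end IsPrimRootMod

lemma legendreSym_congr {p : ℕ} [Fact p.Prime] {a b : ℤ} (h : (p : ℤ) ∣ a - b) :
    legendreSym p a = legendreSym p b := by
  rw [legendreSym.mod p a, legendreSym.mod p b, Int.emod_eq_emod_iff_emod_sub_eq_zero.2
    (Int.emod_eq_zero_of_dvd h)]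

lemma legendreSym_pow (p : ℕ) [Fact p.Prime] (a : ℤ) (n : ℕ) :
    legendreSym p (a ^ n) = legendreSym p a ^ n :=
  map_pow (legendreSym.hom p) a n

lemma IsPrimRootMod.exists_dvd_pow_mul_add_two {p g : ℕ} (hp : p.Prime) (hp2 : p ≠ 2)
    (hg : IsPrimRootMod g (p ^ 2)) {n : ℕ} (hn : 0 < n) {s : ℕ} (hs : ¬ p ∣ s) :
    ∃ i : ℕ, ∀ j, j ≡ i [MOD (p ^ n).totient] → (p ^ n : ℤ) ∣ (g : ℤ) ^ j * s + 2 := by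
  obtain ⟨u, hu⟩ : IsUnit (2 : ZMod (p ^ n)) := by
    have : IsUnit ((2 : ℕ) : ZMod (p ^ n)) := by
      rw [ZMod.isUnit_iff_coprime]
      exact ((Nat.coprime_primes Nat.prime_two hp).2 hp2.symm).pow_right n
    exact_mod_cast this
  obtain ⟨v, hv⟩ : IsUnit (s : ZMod (p ^ n)) := by
    rw [ZMod.isUnit_iff_coprime]
    exact ((Nat.Prime.coprime_iff_not_dvd hp).2 hs).symm.pow_right n
  obtain ⟨i, hi⟩ := hg.exists_pow_eq hp hp2 hn (-u * v⁻¹)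
  refine ⟨i, fun j hj => ?_⟩
  have h1 := hi j hj
  have h2 := (ZMod.intCast_zmod_eq_zero_iff_dvd ((g : ℤ) ^ j * s + 2) (p ^ n)).1 (by
    push_cast
    rw [h1, ← hv, ← hu]
    simp)
  exact_mod_cast h2

lemma mod_two_eq_of_legendreSym {p g : ℕ} [Fact p.Prime] {i s : ℕ} (hg : legendreSym p g = -1)
    (hs : legendreSym p s = 1) (hi : (p : ℤ) ∣ (g : ℤ) ^ i * s + 2) :
    (-1) ^ i = legendreSym p (-2) := by
  rw [← legendreSym_congr (a := (g : ℤ) ^ i * s) (by simpa using hi), legendreSym.mul, hs,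
    legendreSym_pow, hg, mul_one]

/-- The Chinese remainder step determining the third exponent. -/
lemma exists_exponent {p q r : ℕ} (hp : p.Prime) (hq : q.Prime)
    (hlt : p < q) (h8 : p % 8 = q % 8) (h8' : p % 8 = 3 ∨ p % 8 = 7)
    (hgcd : Nat.gcd (p - 1) (q - 1) = 2) (hqroot : IsPrimRootMod q (p ^ 2))
    (hrroot1 : IsPrimRootMod r (p ^ 2)) (hrroot2 : IsPrimRootMod r (q ^ 2))
    {a b : ℕ} (ha : 0 < a) (hb : 0 < b) (B : ℕ) :
    ∃ c, B < c ∧ (p ^ a : ℤ) ∣ (r : ℤ) ^ c + 2 ∧ (q ^ b : ℤ) ∣ (r : ℤ) ^ c * p ^ a + 2 := by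
  have := Fact.mk hp
  have := Fact.mk hq
  have hp2 : p ≠ 2 := by omega
  have hq2 : q ≠ 2 := by omega
  have hpq : ¬ q ∣ p := fun hd => by have := Nat.le_of_dvd hp.pos hd; omega
  obtain ⟨c₁, hc₁⟩ := hrroot1.exists_dvd_pow_mul_add_two hp hp2 ha (s := 1)
    (by simpa using hp.one_lt.ne')
  obtain ⟨c₂, hc₂⟩ := hrroot2.exists_dvd_pow_mul_add_two hq hq2 hb (s := p ^ a)
    (fun hd => hpq (hq.dvd_of_dvd_pow hd))
  have hqp := hqroot.legendreSym_eq hp hp2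
  have hs : legendreSym q (p ^ a : ℕ) = 1 := by
    rw [Nat.cast_pow, legendreSym_pow,
      legendreSym.quadratic_reciprocity_three_mod_four (by omega) (by omega), hqp, neg_neg, one_pow]
  have e1 := mod_two_eq_of_legendreSym (hrroot1.legendreSym_eq hp hp2) (by simp)
    ((dvd_pow_self (p : ℤ) ha.ne').trans (hc₁ c₁ rfl))
  have e2 := mod_two_eq_of_legendreSym (hrroot2.legendreSym_eq hq hq2) hs
    ((dvd_pow_self (q : ℤ) hb.ne').trans (hc₂ c₂ rfl))
  have hpq8 : (p : ZMod 8) = q := (ZMod.natCast_eq_natCast_iff' p q 8).2 h8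
  rw [legendreSym.at_neg_two hp2, hpq8, ← legendreSym.at_neg_two hq2, ← e2] at e1
  have hpar : c₁ ≡ c₂ [MOD 2] := by
    rcases Nat.even_or_odd c₁ with h | h <;> rcases Nat.even_or_odd c₂ with h' | h' <;>
      simp only [h.neg_one_pow, h'.neg_one_pow] at e1
    · exact (Nat.even_iff.1 h).trans (Nat.even_iff.1 h').symm
    · norm_num at e1
    · norm_num at e1
    · exact (Nat.odd_iff.1 h).trans (Nat.odd_iff.1 h').symm
  have hq1 : ¬ p ∣ q - 1 := by
    intro hd
    have : legendreSym p q = legendreSym p 1 := legendreSym_congr (by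
      have := hq.one_lt
      rw [← Nat.cast_one, ← Nat.cast_sub this.le]
      exact_mod_cast hd)
    rw [hqp, legendreSym.at_one] at this
    norm_num at this
  have hp1 : ¬ q ∣ p - 1 := by
    intro hd
    have := Nat.le_of_dvd (by have := hp.two_le; omega) hd
    omega
  have hg : (p ^ a).totient.gcd (q ^ b).totient = 2 := by
    rw [Nat.totient_prime_pow hp ha, Nat.totient_prime_pow hq hb, ← hgcd]
    have h1 : (p ^ (a - 1)).Coprime (q ^ (b - 1) * (q - 1)) :=
      (Nat.Coprime.mul_right (((Nat.coprime_primes hp hq).2 hlt.ne).pow_right _)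
        ((Nat.Prime.coprime_iff_not_dvd hp).2 hq1)).pow_left _
    have h2 : (q ^ (b - 1)).Coprime (p - 1) :=
      ((Nat.Prime.coprime_iff_not_dvd hq).2 hp1).pow_left _
    rw [Nat.Coprime.gcd_mul_left_cancel _ h1, Nat.Coprime.gcd_mul_left_cancel_right _ h2]
  obtain ⟨c, h1, h2⟩ := Nat.chineseRemainder' (hg ▸ hpar)
  have hpos : 0 < (p ^ a).totient * (q ^ b).totient :=
    Nat.mul_pos (Nat.totient_pos.2 (pow_pos hp.pos _)) (Nat.totient_pos.2 (pow_pos hq.pos _))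
  refine ⟨c + (p ^ a).totient * (q ^ b).totient * (B + 1), ?_, ?_, ?_⟩
  · have := Nat.le_mul_of_pos_left (B + 1) hpos
    omega
  · simpa using hc₁ _ (by
      rw [mul_assoc]
      exact Nat.add_modulus_mul_modEq_iff.2 h1)
  · have := hc₂ (c + (p ^ a).totient * (q ^ b).totient * (B + 1)) (by
      rw [mul_comm (p ^ a).totient, mul_assoc]
      exact Nat.add_modulus_mul_modEq_iff.2 h2)
    exact_mod_cast this

theorem stmt_3 (p q r : ℕ) (hp : p.Prime) (hq : q.Prime) (hr : r.Prime)
    (hlt : p < q) (h8 : p % 8 = q % 8) (h8' : p % 8 = 3 ∨ p % 8 = 7)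
    (hgcd : Nat.gcd (p - 1) (q - 1) = 2)
    (hqroot : IsPrimRootMod q (p ^ 2))
    (hrroot1 : IsPrimRootMod r (p ^ 2)) (hrroot2 : IsPrimRootMod r (q ^ 2)) :
    ∀ a : ℕ, 1 ≤ a → ∃ b c : ℕ, 0 < b ∧ 0 < c ∧
      2 < p ^ a ∧ 2 < q ^ b ∧ 2 < r ^ c ∧
      coeffSet (p ^ a) (q ^ b) (r ^ c) =
        {n : ℤ | -((p : ℤ) ^ a - 1) ≤ 2 * n ∧ 2 * n ≤ (p : ℤ) ^ a + 1} := by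
  intro a ha
  have hp2 : p ≠ 2 := by omega
  have hq2 : q ≠ 2 := by omega
  obtain ⟨h, hh⟩ : Odd (p ^ a) := (hp.odd_of_ne_two hp2).pow
  have hpP : 3 ≤ p ^ a := le_trans (by omega) (Nat.le_self_pow (by omega : a ≠ 0) p)
  have hcop : q.Coprime (p ^ a) := ((Nat.coprime_primes hq hp).2 hlt.ne').pow_right a
  obtain ⟨b, hb, hbig, hdvd⟩ : ∃ b, 0 < b ∧ p ^ a * p ^ a + p ^ a + 1 < q ^ b ∧
      p ^ a ∣ q ^ b - 1 := by
    refine ⟨(p ^ a).totient * (p ^ a * p ^ a + p ^ a + 1), ?_, ?_, ?_⟩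
    · exact Nat.mul_pos (Nat.totient_pos.2 (by omega)) (by omega)
    · refine lt_of_le_of_lt (Nat.le_mul_of_pos_left _ (Nat.totient_pos.2 (by omega)))
        (Nat.lt_pow_self hq.one_lt)
    · rw [pow_mul]
      refine (Nat.modEq_iff_dvd' (Nat.one_le_pow _ _ (Nat.pow_pos hq.pos))).1 ?_
      simpa using ((Nat.ModEq.pow_totient hcop).pow (p ^ a * p ^ a + p ^ a + 1)).symm
  obtain ⟨c, hc, hc1, hc2⟩ := exists_exponent hp hq hlt h8 h8' hgcd hqroot hrroot1 hrroot2 ha hb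
    (p ^ a * q ^ b)
  have hcr : p ^ a * q ^ b < r ^ c := hc.trans (Nat.lt_pow_self hr.one_lt)
  have hQodd : Odd (q ^ b) := (hq.odd_of_ne_two hq2).pow
  have hPodd : Odd (p ^ a) := (hp.odd_of_ne_two hp2).pow
  have hcopPQ : IsCoprime (p ^ a : ℤ) (q ^ b : ℤ) := by
    exact_mod_cast Nat.isCoprime_iff_coprime.2 (hcop.symm.pow_right b)
  have hPQ : p ^ a ≤ p ^ a * q ^ b := Nat.le_mul_of_pos_right _ (Nat.pow_pos hq.pos)
  refine ⟨b, c, hb, by omega, by omega, by omega, by omega, ?_⟩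
  obtain ⟨k, hk⟩ : 2 * p ^ a ∣ q ^ b - 1 :=
    Nat.Coprime.mul_dvd_of_dvd_of_dvd (Nat.coprime_two_left.2 hPodd)
      (Nat.Odd.sub_odd hQodd odd_one).two_dvd hdvd
  have hQ : q ^ b = 1 + 2 * k * p ^ a := by
    have : 1 ≤ q ^ b := Nat.one_le_pow _ _ hq.pos
    rw [mul_right_comm, ← hk]; omega
  have H : IsWindow h k (p ^ a : ℕ) (q ^ b : ℕ) (h + 1 + k * (p ^ a : ℕ)) := by
    refine ⟨by omega, ?_, by exact_mod_cast hh, by exact_mod_cast hQ, rfl⟩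
    rw [Nat.cast_lt]
    by_contra! hle
    have : 2 * k * p ^ a ≤ p ^ a * p ^ a := Nat.mul_le_mul_right _ (by omega)
    omega
  have hδ := H.two_δ
  rw [H.coeffSet_eq ?_ hcr.le]
  · have hhz : (p : ℤ) ^ a = 2 * h + 1 := by exact_mod_cast hh
    ext n
    simp only [Set.mem_ofPred_eq, hhz]
    omega
  · generalize (h + 1 + k * (p ^ a : ℕ) : ℤ) = δ at hδ
    push_cast at hδ ⊢
    have e : (2 : ℤ) * (r ^ c * δ + 1) = r ^ c * (p ^ a + q ^ b) + 2 := by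
      linear_combination (r : ℤ) ^ c * hδ
    have hdvd' : (p ^ a : ℤ) ∣ q ^ b - 1 := ⟨2 * k, by
      have : (q : ℤ) ^ b = 1 + 2 * k * p ^ a := by exact_mod_cast hQ
      rw [this]; ring⟩
    refine hcopPQ.mul_dvd ?_ ?_
    · refine (IsCoprime.dvd_of_dvd_mul_left (y := (2 : ℤ)) ?_ ?_)
      · exact_mod_cast Nat.isCoprime_iff_coprime.2 (Nat.coprime_two_right.2 hPodd)
      · rw [e, show (r : ℤ) ^ c * (p ^ a + q ^ b) + 2 = (r ^ c + 2) + r ^ c * p ^ a +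
          r ^ c * (q ^ b - 1) by ring]
        exact (hc1.add (Dvd.intro_left _ rfl)).add (hdvd'.mul_left _)
    · refine (IsCoprime.dvd_of_dvd_mul_left (y := (2 : ℤ)) ?_ ?_)
      · exact_mod_cast Nat.isCoprime_iff_coprime.2 (Nat.coprime_two_right.2 hQodd)
      · rw [e, show (r : ℤ) ^ c * (p ^ a + q ^ b) + 2 = (r ^ c * p ^ a + 2) + r ^ c * q ^ b by ring]
        exact hc2.add (Dvd.intro_left _ rfl)
end

section
/- For every positive integer a there exist positive integers b and c such that the coefficient set A_{3^a,11^b,2^c} of the unitary cyclotomic polynomial Φ*_{3^a·11^b·2^c} equals exactly the set of integers n with −(3^a−1)/2 ≤ n ≤ (3^a+1)/2. -/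
open Polynomial

/-- The sign of the monomial indexed by `(x, y)` in the binary inclusion-exclusion polynomial. -/
def binWeight (μ l x y : ℕ) : ℤ :=
  if x < μ then (if y < l then 1 else 0) else (if y < l then 0 else -1)

/-- The exponent of the monomial indexed by `(x, y)` in the binary inclusion-exclusion
polynomial. -/
def binExp (p q μ x y : ℕ) : ℕ :=
  if x < μ then x * p + y * q else x * p + y * q - p * q

/-- The binary inclusion-exclusion polynomial `(X^{pq}-1)(X-1)/((X^p-1)(X^q-1))`, written through
the solution `(μ, l)` of `pμ + ql = pq + 1`. -/
noncomputable def binPoly (p q μ l : ℕ) : ℤ[X] :=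
  ∑ x ∈ Finset.range q, ∑ y ∈ Finset.range p,
    C (binWeight μ l x y) * X ^ binExp p q μ x y

theorem binPoly_eq {p q μ l : ℕ} (hμ : μ ≤ q) (hl : l ≤ p) :
    binPoly p q μ l =
      (∑ x ∈ Finset.range μ, ((X : ℤ[X]) ^ p) ^ x) * (∑ y ∈ Finset.range l, (X ^ q) ^ y) -
        ∑ x ∈ Finset.Ico μ q, ∑ y ∈ Finset.Ico l p, X ^ (x * p + y * q - p * q) := by
  have h1 : ∀ x ∈ Finset.range μ, ∑ y ∈ Finset.range p,
      C (binWeight μ l x y) * (X : ℤ[X]) ^ binExp p q μ x y =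
        (X ^ p) ^ x * ∑ y ∈ Finset.range l, (X ^ q) ^ y := by
    intro x hx
    rw [Finset.mem_range] at hx
    rw [← Finset.sum_range_add_sum_Ico _ hl, Finset.mul_sum]
    have hz : ∑ y ∈ Finset.Ico l p, C (binWeight μ l x y) * (X : ℤ[X]) ^ binExp p q μ x y = 0 := by
      refine Finset.sum_eq_zero fun y hy => ?_
      rw [Finset.mem_Ico] at hy
      simp [binWeight, hx, hy.1.not_gt]
    rw [hz, add_zero]
    refine Finset.sum_congr rfl fun y hy => ?_
    rw [Finset.mem_range] at hy
    simp only [binWeight, binExp, hx, hy, if_true, map_one, one_mul]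
    ring
  have h2 : ∀ x ∈ Finset.Ico μ q, ∑ y ∈ Finset.range p,
      C (binWeight μ l x y) * (X : ℤ[X]) ^ binExp p q μ x y =
        -∑ y ∈ Finset.Ico l p, X ^ (x * p + y * q - p * q) := by
    intro x hx
    rw [Finset.mem_Ico] at hx
    rw [← Finset.sum_range_add_sum_Ico _ hl]
    have hz : ∑ y ∈ Finset.range l, C (binWeight μ l x y) * (X : ℤ[X]) ^ binExp p q μ x y = 0 := by
      refine Finset.sum_eq_zero fun y hy => ?_
      rw [Finset.mem_range] at hy
      simp [binWeight, hx.1.not_gt, hy]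
    rw [hz, zero_add, ← Finset.sum_neg_distrib]
    refine Finset.sum_congr rfl fun y hy => ?_
    rw [Finset.mem_Ico] at hy
    simp [binWeight, binExp, hx.1.not_gt, hy.1.not_gt]
  rw [binPoly, ← Finset.sum_range_add_sum_Ico _ hμ, Finset.sum_congr rfl h1,
    Finset.sum_congr rfl h2, Finset.sum_neg_distrib, ← Finset.sum_mul, sub_eq_add_neg]

theorem binPoly_mul {p q μ l : ℕ} (hμ : μ ≤ q) (hl : l ≤ p) (h : p * μ + q * l = p * q + 1) :
    binPoly p q μ l * ((X ^ p - 1) * (X ^ q - 1)) = (X ^ (p * q) - 1) * (X - 1) := by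
  set S := ∑ x ∈ Finset.Ico μ q, ∑ y ∈ Finset.Ico l p, (X : ℤ[X]) ^ (x * p + y * q - p * q)
    with hS
  have hS' : X ^ (p * q) * S =
      (∑ x ∈ Finset.Ico μ q, ((X : ℤ[X]) ^ p) ^ x) * (∑ y ∈ Finset.Ico l p, (X ^ q) ^ y) := by
    rw [hS, Finset.mul_sum, Finset.sum_mul]
    refine Finset.sum_congr rfl fun x hx => ?_
    rw [Finset.mul_sum, Finset.mul_sum]
    refine Finset.sum_congr rfl fun y hy => ?_
    rw [Finset.mem_Ico] at hx hy
    have h1 : μ * p ≤ x * p := Nat.mul_le_mul_right _ hx.1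
    have h2 : l * q ≤ y * q := Nat.mul_le_mul_right _ hy.1
    rw [← pow_add, ← pow_mul, ← pow_mul, ← pow_add]
    congr 1
    rw [mul_comm p x, mul_comm q y]
    have : p * q ≤ x * p + y * q := by nlinarith
    omega
  have e1 := geom_sum_mul ((X : ℤ[X]) ^ p) μ
  have e2 := geom_sum_mul ((X : ℤ[X]) ^ q) l
  have e3 := geom_sum_Ico_mul ((X : ℤ[X]) ^ p) hμ
  have e4 := geom_sum_Ico_mul ((X : ℤ[X]) ^ q) hl
  rw [← pow_mul] at e1 e2 e3 e4
  rw [← pow_mul] at e3 e4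
  rw [mul_comm q p] at e4
  have hX : (X : ℤ[X]) ^ (p * μ) * X ^ (q * l) = X ^ (p * q) * X := by
    rw [← pow_add, h, pow_succ]
  rw [binPoly_eq hμ hl, ← hS]
  apply mul_left_cancel₀ (pow_ne_zero (p * q) (X_ne_zero (R := ℤ)))
  linear_combination (X ^ (p * q) * (∑ y ∈ Finset.range l, (X ^ q) ^ y) * (X ^ q - 1)) * e1 +
    (X ^ (p * q) * (X ^ (p * μ) - 1)) * e2 - (X ^ p - 1) * (X ^ q - 1) * hS' -
    ((∑ y ∈ Finset.Ico l p, (X ^ q) ^ y) * (X ^ q - 1)) * e3 -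
    (X ^ (p * q) - X ^ (p * μ)) * e4 + (X ^ (p * q) - 1) * hX

/-- The polynomial `X^n - 1` over `ℤ` divides every polynomial vanishing at all complex `n`-th
roots of unity. -/
theorem X_pow_sub_one_dvd_of_eval {n : ℕ} (hn : n ≠ 0) (F : ℤ[X])
    (h : ∀ z : ℂ, z ^ n = 1 → aeval z F = 0) : X ^ n - 1 ∣ F := by
  have hm : (X ^ n - 1 : ℤ[X]).Monic := monic_X_pow_sub_C 1 hn
  rw [← map_dvd_map (Int.castRingHom ℂ) Int.cast_injective hm]
  simp only [Polynomial.map_sub, Polynomial.map_pow, map_X, Polynomial.map_one]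
  have hprim := Complex.isPrimitiveRoot_exp n hn
  rw [X_pow_sub_one_eq_prod (Nat.pos_of_ne_zero hn) hprim]
  refine Finset.prod_dvd_of_coprime ?_ ?_
  · intro a _ b _ hab
    exact pairwise_coprime_X_sub_C (s := (id : ℂ → ℂ)) Function.injective_id hab
  · intro z hz
    rw [dvd_iff_isRoot, IsRoot, eval_map]
    exact h z ((mem_nthRootsFinset (Nat.pos_of_ne_zero hn) (1 : ℂ)).1 hz)

theorem exists_ternary_quotient {p q r μ l : ℕ} (hp : 0 < p) (hq : 0 < q)
    (hpr : p.Coprime r) (hqr : q.Coprime r)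
    (hμ : μ ≤ q) (hl : l ≤ p) (h : p * μ + q * l = p * q + 1) :
    ∃ Q : ℤ[X], expand ℤ r (binPoly p q μ l) *
      ((∑ i ∈ Finset.range p, X ^ i) * (X ^ q - 1)) = (X ^ (p * q) - 1) * Q := by
  have eq_one {z : ℂ} {m n : ℕ} (hmn : m.Coprime n) (h1 : z ^ m = 1) (h2 : z ^ n = 1) :
      z = 1 := by
    have := orderOf_dvd_of_pow_eq_one h1
    have := orderOf_dvd_of_pow_eq_one h2
    rw [← orderOf_eq_one_iff]
    exact Nat.eq_one_of_dvd_coprimes hmn ‹_› ‹_›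
  refine X_pow_sub_one_dvd_of_eval (by positivity) _ fun z hz => ?_
  simp only [map_mul, map_sum, map_pow, aeval_X, map_sub, map_one, expand_aeval]
  by_cases hzq : z ^ q = 1
  · simp [hzq]
  by_cases hzp : z ^ p = 1
  · have hz1 : z ≠ 1 := by rintro rfl; simp at hzq
    have := geom_sum_mul z p
    rw [hzp, sub_self, mul_eq_zero] at this
    rw [this.resolve_right (sub_ne_zero.2 hz1)]
    simp
  have key := congrArg (aeval (z ^ r)) (binPoly_mul hμ hl h)
  simp only [map_mul, map_pow, aeval_X, map_sub, map_one] at key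
  have hzr : (z ^ r) ^ (p * q) = 1 := by rw [← pow_mul, mul_comm, pow_mul, hz, one_pow]
  rw [hzr, sub_self, zero_mul, mul_eq_zero, mul_eq_zero, sub_eq_zero, sub_eq_zero] at key
  rcases key with key | key | key
  · simp [key]
  · refine absurd (eq_one hqr (z := z ^ p) ?_ ?_) hzp
    · rw [← pow_mul, hz]
    · rw [← pow_mul, mul_comm, pow_mul, key]
  · refine absurd (eq_one hpr (z := z ^ q) ?_ ?_) hzq
    · rw [← pow_mul, mul_comm, hz]
    · rw [← pow_mul, mul_comm, pow_mul, key]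

theorem Qpoly_spec {p q r μ l : ℕ} (hp : 0 < p) (hq : 0 < q) (hr : 0 < r)
    (hpr : p.Coprime r) (hqr : q.Coprime r)
    (hμ : μ ≤ q) (hl : l ≤ p) (h : p * μ + q * l = p * q + 1) :
    expand ℤ r (binPoly p q μ l) * ((∑ i ∈ Finset.range p, X ^ i) * (X ^ q - 1)) =
      (X ^ (p * q) - 1) * Qpoly p q r ∧
    (Qpoly p q r).natDegree ≤ (p - 1) * (q - 1) * (r - 1) := by
  obtain ⟨Q, hQ⟩ := exists_ternary_quotient hp hq hpr hqr hμ hl h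
  have monic {n : ℕ} (hn : 0 < n) : (X ^ n - 1 : ℤ[X]).Monic := monic_X_pow_sub_C 1 hn.ne'
  have deg (n : ℕ) : (X ^ n - 1 : ℤ[X]).natDegree = n := natDegree_X_pow_sub_C (r := (1 : ℤ))
  have monic1 : (X - 1 : ℤ[X]).Monic := monic_X_sub_C 1
  have deg1 : (X - 1 : ℤ[X]).natDegree = 1 := natDegree_X_sub_C 1
  have hpq' : 0 < p * q := by positivity
  have hqr' : 0 < q * r := by positivity
  have hrp' : 0 < r * p := by positivity
  have hpqr' : 0 < p * q * r := by positivity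
  have mD := (((monic hpq').mul (monic hqr')).mul (monic hrp')).mul monic1
  have mN := (((monic hpqr').mul (monic hp)).mul (monic hq)).mul (monic hr)
  have hexp := congrArg (expand ℤ r) (binPoly_mul hμ hl h)
  simp only [map_mul, map_sub, map_pow, expand_X, map_one, ← pow_mul] at hexp
  have hND : (X ^ (p * q * r) - 1) * (X ^ p - 1) * (X ^ q - 1) * (X ^ r - 1) =
      ((X ^ (p * q) - 1) * (X ^ (q * r) - 1) * (X ^ (r * p) - 1) * (X - 1)) * Q := by
    have hg := geom_sum_mul (X : ℤ[X]) p
    rw [show p * q * r = r * (p * q) by ring, show q * r = r * q by ring]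
    linear_combination (-(X ^ p - 1) * (X ^ q - 1)) * hexp -
      (expand ℤ r (binPoly p q μ l) * (X ^ (r * p) - 1) * (X ^ (r * q) - 1) * (X ^ q - 1)) * hg +
      ((X ^ (r * q) - 1) * (X ^ (r * p) - 1) * (X - 1)) * hQ
  have hQQ : Qpoly p q r = Q := by
    rw [Qpoly, hND, mul_divByMonic_cancel_left _ mD]
  rw [hQQ]
  refine ⟨hQ, ?_⟩
  have mQ : Q.Monic := mD.of_mul_monic_left (hND ▸ mN)
  have hdeg := congrArg natDegree hND
  rw [mD.natDegree_mul mQ, (((monic hpqr').mul (monic hp)).mul (monic hq)).natDegree_mul (monic hr),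
    ((monic hpqr').mul (monic hp)).natDegree_mul (monic hq), (monic hpqr').natDegree_mul (monic hp),
    (((monic hpq').mul (monic hqr')).mul (monic hrp')).natDegree_mul monic1,
    ((monic hpq').mul (monic hqr')).natDegree_mul (monic hrp'),
    (monic hpq').natDegree_mul (monic hqr'), deg, deg, deg, deg, deg, deg, deg, deg1] at hdeg
  obtain ⟨p, rfl⟩ := Nat.exists_eq_add_of_lt hp
  obtain ⟨q, rfl⟩ := Nat.exists_eq_add_of_lt hq
  obtain ⟨r, rfl⟩ := Nat.exists_eq_add_of_lt hr
  simp only [zero_add, add_tsub_cancel_right] at hdeg ⊢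
  nlinarith

/-- The signed number of monomials `(x, y)` of the binary polynomial whose exponent `e` satisfies
`r e ≤ n` and `r e + d ≡ n` modulo `pq`. -/
def congrSum (p q r μ l n d : ℕ) : ℤ :=
  ∑ x ∈ Finset.range q, ∑ y ∈ Finset.range p,
    if r * binExp p q μ x y ≤ n ∧ (r * binExp p q μ x y + d) % (p * q) = n % (p * q)
    then binWeight μ l x y else 0

/-- The power series `∑ X^(N i)`. -/
noncomputable def multiplesSeries (N : ℕ) : PowerSeries ℤ :=
  PowerSeries.mk fun n => if N ∣ n then 1 else 0

theorem X_pow_sub_one_mul_multiplesSeries {N : ℕ} (hN : 0 < N) :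
    ((PowerSeries.X : PowerSeries ℤ) ^ N - 1) * multiplesSeries N = -1 := by
  ext n
  rw [sub_mul, one_mul, map_sub, PowerSeries.coeff_X_pow_mul', map_neg, PowerSeries.coeff_one]
  simp only [multiplesSeries, PowerSeries.coeff_mk]
  by_cases hn : N ≤ n
  · have h0 : n ≠ 0 := by omega
    have hd : N ∣ n - N ↔ N ∣ n := by
      rw [← Nat.dvd_add_self_right (n := n - N), Nat.sub_add_cancel hn]
    simp [hn, h0, hd]
  · rcases Nat.eq_zero_or_pos n with rfl | h0
    · simp [hN.ne']
    · have : ¬ N ∣ n := fun h => hn (Nat.le_of_dvd h0 h)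
      simp [hn, h0.ne', this]

theorem coeff_expand_mul_multiplesSeries (p q r μ l n : ℕ) {d : ℕ} (hd : d < p * q) :
    PowerSeries.coeff n (((expand ℤ r (binPoly p q μ l) : ℤ[X]) : PowerSeries ℤ) *
      PowerSeries.X ^ d * multiplesSeries (p * q)) = congrSum p q r μ l n d := by
  have hcoe : ((expand ℤ r (binPoly p q μ l) : ℤ[X]) : PowerSeries ℤ) =
      ∑ x ∈ Finset.range q, ∑ y ∈ Finset.range p,
        PowerSeries.C (binWeight μ l x y) * PowerSeries.X ^ (r * binExp p q μ x y) := by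
    rw [binPoly, map_sum, ← coeToPowerSeries.ringHom_apply, map_sum]
    refine Finset.sum_congr rfl fun x _ => ?_
    rw [map_sum, map_sum]
    refine Finset.sum_congr rfl fun y _ => ?_
    rw [map_mul, map_pow, expand_C, expand_X, coeToPowerSeries.ringHom_apply, coe_mul, coe_C,
      coe_pow, coe_pow, coe_X, ← pow_mul]
  rw [hcoe, congrSum, Finset.sum_mul, Finset.sum_mul, map_sum]
  refine Finset.sum_congr rfl fun x _ => ?_
  rw [Finset.sum_mul, Finset.sum_mul, map_sum]
  refine Finset.sum_congr rfl fun y _ => ?_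
  rw [mul_assoc (PowerSeries.C _), ← pow_add, mul_assoc, PowerSeries.coeff_C_mul,
    PowerSeries.coeff_X_pow_mul']
  simp only [multiplesSeries, PowerSeries.coeff_mk]
  rw [← ite_and]
  set e := r * binExp p q μ x y
  have hiff : (e + d ≤ n ∧ p * q ∣ n - (e + d)) ↔ (e ≤ n ∧ (e + d) % (p * q) = n % (p * q)) := by
    constructor
    · rintro ⟨h1, h2⟩
      exact ⟨by omega, (Nat.modEq_iff_dvd' h1).2 h2⟩
    · rintro ⟨h1, h2⟩
      have h3 : e + d ≤ n := by
        by_contra! hlt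
        have := Nat.le_of_dvd (by omega) ((Nat.modEq_iff_dvd' hlt.le).1 h2.symm)
        omega
      exact ⟨h3, (Nat.modEq_iff_dvd' h3).1 h2⟩
  simp only [hiff, mul_ite, mul_one, mul_zero]

section Coefficients

variable {p q r μ l : ℕ} {Q : ℤ[X]}

theorem coeff_eq_sum_congrSum (hpq : p + q < p * q)
    (hQ : expand ℤ r (binPoly p q μ l) * ((∑ i ∈ Finset.range p, X ^ i) * (X ^ q - 1)) =
      (X ^ (p * q) - 1) * Q) (n : ℕ) :
    Q.coeff n =
      ∑ i ∈ Finset.range p, (congrSum p q r μ l n i - congrSum p q r μ l n (i + q)) := by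
  have hT := X_pow_sub_one_mul_multiplesSeries (N := p * q) (by omega)
  have hQ' := congrArg (fun F : ℤ[X] => (F : PowerSeries ℤ)) hQ
  simp only [coe_mul, coe_sub, coe_pow, coe_X, coe_one] at hQ'
  rw [← coeToPowerSeries.ringHom_apply (φ := ∑ i ∈ Finset.range p, X ^ i), map_sum] at hQ'
  simp only [coeToPowerSeries.ringHom_apply, coe_pow, coe_X] at hQ'
  set E : PowerSeries ℤ := ((expand ℤ r (binPoly p q μ l) : ℤ[X]) : PowerSeries ℤ) with hE
  have key : (Q : PowerSeries ℤ) = ∑ i ∈ Finset.range p,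
      (E * PowerSeries.X ^ i * multiplesSeries (p * q) -
        E * PowerSeries.X ^ (i + q) * multiplesSeries (p * q)) := by
    have : ∀ i ∈ Finset.range p, E * PowerSeries.X ^ i * multiplesSeries (p * q) -
        E * PowerSeries.X ^ (i + q) * multiplesSeries (p * q) =
        (PowerSeries.X ^ i) * (E * multiplesSeries (p * q) * (1 - PowerSeries.X ^ q)) :=
      fun i _ => by ring
    rw [Finset.sum_congr rfl this, ← Finset.sum_mul]
    linear_combination (Q : PowerSeries ℤ) * hT + (multiplesSeries (p * q)) * hQ'
  rw [← coeff_coe, key, map_sum]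
  refine Finset.sum_congr rfl fun i hi => ?_
  rw [Finset.mem_range] at hi
  rw [map_sub, hE, coeff_expand_mul_multiplesSeries _ _ _ _ _ _ (by omega),
    coeff_expand_mul_multiplesSeries _ _ _ _ _ _ (by omega)]

theorem coeff_succ_sub_coeff (hpq : p + q < p * q)
    (hQ : expand ℤ r (binPoly p q μ l) * ((∑ i ∈ Finset.range p, X ^ i) * (X ^ q - 1)) =
      (X ^ (p * q) - 1) * Q) (n : ℕ) :
    Q.coeff (n + 1) - Q.coeff n =
      congrSum p q r μ l (n + 1) 0 - congrSum p q r μ l (n + 1) p -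
        congrSum p q r μ l (n + 1) q + congrSum p q r μ l (n + 1) (p + q) := by
  have hT := X_pow_sub_one_mul_multiplesSeries (N := p * q) (by omega)
  have hQ2 : expand ℤ r (binPoly p q μ l) * ((X ^ p - 1) * (X ^ q - 1)) =
      (X ^ (p * q) - 1) * (Q * (X - 1)) := by
    linear_combination (X - 1) * hQ -
      expand ℤ r (binPoly p q μ l) * (X ^ q - 1) * geom_sum_mul (X : ℤ[X]) p
  have hQ' := congrArg (fun F : ℤ[X] => (F : PowerSeries ℤ)) hQ2
  simp only [coe_mul, coe_sub, coe_pow, coe_X, coe_one] at hQ'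
  set E : PowerSeries ℤ := ((expand ℤ r (binPoly p q μ l) : ℤ[X]) : PowerSeries ℤ) with hE
  have key : (Q : PowerSeries ℤ) - PowerSeries.X * (Q : PowerSeries ℤ) =
      E * PowerSeries.X ^ 0 * multiplesSeries (p * q) -
        E * PowerSeries.X ^ p * multiplesSeries (p * q) -
        E * PowerSeries.X ^ q * multiplesSeries (p * q) +
        E * PowerSeries.X ^ (p + q) * multiplesSeries (p * q) := by
    linear_combination ((Q : PowerSeries ℤ) * (1 - PowerSeries.X)) * hT -
      (multiplesSeries (p * q)) * hQ'
  have hc := congrArg (PowerSeries.coeff (n + 1)) key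
  simp only [map_sub, map_add, PowerSeries.coeff_succ_X_mul, coeff_coe] at hc
  rw [hc, hE, coeff_expand_mul_multiplesSeries _ _ _ _ _ _ (by omega),
    coeff_expand_mul_multiplesSeries _ _ _ _ _ _ (by omega),
    coeff_expand_mul_multiplesSeries _ _ _ _ _ _ (by omega),
    coeff_expand_mul_multiplesSeries _ _ _ _ _ _ (by omega)]

end Coefficients

/-- The weight of `(x, y)`, discarded when its exponent exceeds `J`. -/
def cutWeight (p q μ l J x y : ℕ) : ℤ :=
  if binExp p q μ x y ≤ J then binWeight μ l x y else 0

theorem congrSum_eq_cutWeight {p q r μ l : ℕ} (hp : 0 < p) (hq : 0 < q) (hr : 0 < r)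
    (hcop : p.Coprime q) (h : p * μ + q * l = p * q + 1) {β : ℤ}
    (hinv : ((p * q : ℕ) : ℤ) ∣ β * r - 1) {n d X Y : ℕ}
    (hXY : ((p * q : ℕ) : ℤ) ∣ X * p + Y * q + β * (d - n)) :
    congrSum p q r μ l n d = cutWeight p q μ l (n / r) (X % q) (Y % p) := by
  have hcop' : IsCoprime (p : ℤ) q := Nat.isCoprime_iff_coprime.2 hcop
  have hcopβ : IsCoprime ((p * q : ℕ) : ℤ) β := by
    obtain ⟨w, hw⟩ := hinv
    exact ⟨-w, r, by linear_combination hw⟩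
  have hmod : ∀ x < q, ∀ y < p, binWeight μ l x y ≠ 0 →
      ((r * binExp p q μ x y + d) % (p * q) = n % (p * q) ↔ x = X % q ∧ y = Y % p) := by
    intro x hx y hy hw
    have he : ((p * q : ℕ) : ℤ) ∣ (binExp p q μ x y : ℤ) - (x * p + y * q) := by
      unfold binExp
      split_ifs with hxμ
      · push_cast
        simp
      · have hyl : l ≤ y := by
          by_contra hyl
          exact hw (by simp [binWeight, hxμ, not_le.1 hyl])
        have h1 : μ * p ≤ x * p := Nat.mul_le_mul_right _ (not_lt.1 hxμ)
        have h2 : l * q ≤ y * q := Nat.mul_le_mul_right _ hyl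
        have h3 : p * q ≤ x * p + y * q := by nlinarith
        push_cast [Nat.cast_sub h3]
        exact ⟨-1, by ring⟩
    set e := binExp p q μ x y
    have step : (r * e + d) % (p * q) = n % (p * q) ↔
        ((p * q : ℕ) : ℤ) ∣ (X - x) * p + (Y - y) * q := by
      change r * e + d ≡ n [MOD p * q] ↔ _
      rw [Nat.ModEq.comm, Nat.modEq_iff_dvd]
      have hlin : ((X : ℤ) - x) * p + (Y - y) * q =
          (X * p + Y * q + β * (d - n)) + (e - (x * p + y * q)) -
            β * (((r * e + d : ℕ) : ℤ) - n) + (β * r - 1) * e := by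
        push_cast
        ring
      rw [hlin, dvd_add_left (hinv.mul_right _), dvd_sub_right (dvd_add hXY he)]
      exact ⟨fun h => h.mul_left _, hcopβ.dvd_of_dvd_mul_left⟩
    rw [step]
    constructor
    · intro hdvd
      have hpd : (p : ℤ) ∣ ((p * q : ℕ) : ℤ) := ⟨q, by push_cast; ring⟩
      have hqd : (q : ℤ) ∣ ((p * q : ℕ) : ℤ) := ⟨p, by push_cast; ring⟩
      have h1 : (p : ℤ) ∣ Y - y := hcop'.dvd_of_dvd_mul_right
        ((dvd_add_right (Dvd.intro_left _ rfl)).1 (hpd.trans hdvd))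
      have h2 : (q : ℤ) ∣ X - x := hcop'.symm.dvd_of_dvd_mul_right
        ((dvd_add_left (Dvd.intro_left _ rfl)).1 (hqd.trans hdvd))
      have h1' : y % p = Y % p := Nat.modEq_iff_dvd.2 h1
      have h2' : x % q = X % q := Nat.modEq_iff_dvd.2 h2
      rw [Nat.mod_eq_of_lt hy] at h1'
      rw [Nat.mod_eq_of_lt hx] at h2'
      exact ⟨h2', h1'⟩
    · rintro ⟨rfl, rfl⟩
      have h1 : (q : ℤ) ∣ X - (X % q : ℕ) := Nat.modEq_iff_dvd.1 (Nat.mod_modEq X q)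
      have h2 : (p : ℤ) ∣ Y - (Y % p : ℕ) := Nat.modEq_iff_dvd.1 (Nat.mod_modEq Y p)
      push_cast at h1 h2 ⊢
      refine dvd_add ?_ ?_
      · rw [mul_comm (p : ℤ)]
        exact mul_dvd_mul_right h1 _
      · rw [mul_comm (p : ℤ), mul_comm _ (q : ℤ)]
        exact mul_dvd_mul_left _ h2
  have hterm : ∀ x < q, ∀ y < p,
      (if r * binExp p q μ x y ≤ n ∧ (r * binExp p q μ x y + d) % (p * q) = n % (p * q)
        then binWeight μ l x y else 0) =
      if x = X % q then (if y = Y % p then cutWeight p q μ l (n / r) x y else 0) else 0 := by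
    intro x hx y hy
    by_cases hw : binWeight μ l x y = 0
    · simp [cutWeight, hw]
    · simp only [hmod x hx y hy hw, cutWeight, Nat.le_div_iff_mul_le hr]
      rw [mul_comm r]
      clear hmod
      split_ifs <;> tauto
  have hsum : congrSum p q r μ l n d = ∑ x ∈ Finset.range q, ∑ y ∈ Finset.range p,
      if x = X % q then (if y = Y % p then cutWeight p q μ l (n / r) x y else 0) else 0 :=
    Finset.sum_congr rfl fun x hx => Finset.sum_congr rfl fun y hy =>
      hterm x (Finset.mem_range.1 hx) y (Finset.mem_range.1 hy)
  rw [hsum, Finset.sum_eq_single_of_mem (X % q) (Finset.mem_range.2 (Nat.mod_lt _ hq)),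
    Finset.sum_eq_single_of_mem (Y % p) (Finset.mem_range.2 (Nat.mod_lt _ hp))]
  · simp
  · intro y _ hy
    simp [hy]
  · intro x _ hx
    simp [hx]

theorem congrSum_eq_cutWeight_of_dvd {p q r μ l : ℕ} (hp : 0 < p) (hq : 0 < q) (hr : 0 < r)
    (hcop : p.Coprime q) (h : p * μ + q * l = p * q + 1)
    (hinv : p * q ∣ 2 * r + 1) {n d X Y : ℕ}
    (hXY : X * p + Y * q + 2 * n ≡ 2 * d [MOD p * q]) :
    congrSum p q r μ l n d = cutWeight p q μ l (n / r) (X % q) (Y % p) := by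
  refine congrSum_eq_cutWeight (β := -2) hp hq hr hcop h ?_ ?_
  · obtain ⟨w, hw⟩ := hinv
    refine ⟨-w, ?_⟩
    zify at hw
    push_cast
    linear_combination -hw
  · obtain ⟨w, hw⟩ := Nat.modEq_iff_dvd.1 hXY.symm
    refine ⟨w, ?_⟩
    push_cast at hw ⊢
    linear_combination hw

theorem abs_cutWeight_corners_le_one (p q μ l J x x' y y' : ℕ) :
    |cutWeight p q μ l J x y - cutWeight p q μ l J x' y - cutWeight p q μ l J x y' +
      cutWeight p q μ l J x' y'| ≤ 1 := by
  unfold cutWeight binWeight binExp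
  rw [abs_le]
  split_ifs <;> omega

theorem exists_eq_of_abs_sub_le_one {f : ℕ → ℤ} (hf : ∀ n, |f (n + 1) - f n| ≤ 1) {v : ℤ}
    (h0 : f 0 ≤ v) : ∀ N, v ≤ f N → ∃ n ≤ N, f n = v
  | 0, hN => ⟨0, le_rfl, le_antisymm h0 hN⟩
  | N + 1, hN => by
    by_cases hv : v ≤ f N
    · obtain ⟨n, hn, h⟩ := exists_eq_of_abs_sub_le_one hf h0 N hv
      exact ⟨n, hn.trans N.le_succ, h⟩
    · have := (abs_le.1 (hf N)).2
      exact ⟨N + 1, le_rfl, by omega⟩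

theorem exists_eq_of_abs_sub_le_one_of_mem {f : ℕ → ℤ} (hf : ∀ n, |f (n + 1) - f n| ≤ 1)
    {M N : ℕ} {v : ℤ} (hM : f M ≤ v) (hN : v ≤ f N) : ∃ n ≤ max M N, f n = v := by
  rcases le_total (f 0) v with h0 | h0
  · obtain ⟨n, hn, h⟩ := exists_eq_of_abs_sub_le_one hf h0 N hN
    exact ⟨n, hn.trans (le_max_right _ _), h⟩
  · obtain ⟨n, hn, h⟩ := exists_eq_of_abs_sub_le_one (f := fun n => -f n) (v := -v)
      (fun n => by rw [← abs_neg]; convert hf n using 2; ring) (by simpa using h0) M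
      (by simpa using hM)
    exact ⟨n, hn.trans (le_max_left _ _), neg_inj.1 h⟩

/-- The number of residues below `l` in a window of length `p`. -/
theorem sum_range_ite_mod_lt {p l : ℕ} (hl : l ≤ p) (Y : ℕ) :
    ∑ m ∈ Finset.range p, (if (Y + m) % p < l then (1 : ℤ) else 0) = l := by
  have hper : Function.Periodic (fun m => m % p < l) p := fun m => by simp
  have h := Nat.filter_Ico_card_eq_of_periodic Y p (fun m => m % p < l) hper
  rw [Nat.count_eq_card_filter_range] at h
  have hcard : (Finset.range p).filter (fun m => m % p < l) = Finset.range l := by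
    ext m
    simp only [Finset.mem_filter, Finset.mem_range]
    constructor
    · rintro ⟨h1, h2⟩
      rwa [Nat.mod_eq_of_lt h1] at h2
    · intro h1
      have h2 : m < p := h1.trans_le hl
      exact ⟨h2, by rwa [Nat.mod_eq_of_lt h2]⟩
  rw [hcard, Finset.card_range] at h
  have hs := Finset.sum_Ico_eq_sum_range (fun m => if m % p < l then (1 : ℤ) else 0) Y (Y + p)
  rw [add_tsub_cancel_left] at hs
  rw [← hs, Finset.sum_boole, h]

theorem cutWeight_sub_shift_bounds {h q μ J x y : ℕ} (hh : 2 ≤ h) (hy : y < 2 * h + 1) :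
    (if y < h + 1 then 0 else -1) ≤ cutWeight (2 * h + 1) q μ (h + 1) J x y -
        cutWeight (2 * h + 1) q μ (h + 1) J x ((y + 2) % (2 * h + 1)) ∧
    cutWeight (2 * h + 1) q μ (h + 1) J x y -
        cutWeight (2 * h + 1) q μ (h + 1) J x ((y + 2) % (2 * h + 1)) ≤
      (if y < h + 1 then 1 else 0) := by
  rcases lt_or_ge (y + 2) (2 * h + 1) with hlt | hge
  · rw [Nat.mod_eq_of_lt hlt]
    unfold cutWeight binWeight binExp
    rw [add_mul y 2 q]
    split_ifs <;> omega
  · have : (y + 2) % (2 * h + 1) = y + 2 - (2 * h + 1) := by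
      rw [Nat.mod_eq_sub_mod hge, Nat.mod_eq_of_lt (by omega)]
    rw [this]
    unfold cutWeight binWeight
    split_ifs <;> omega

theorem exists_div_eq_and_dvd {N r : ℕ} (hN : 0 < N) (hr : N ≤ r) (hinv : N ∣ 2 * r + 1)
    (J Z : ℕ) : ∃ n, n / r = J ∧ N ∣ Z + 2 * n := by
  set i := (r * Z + (N - 1) * (r * J)) % N with hi
  have hlt : i < N := Nat.mod_lt _ hN
  refine ⟨i + r * J, ?_, ?_⟩
  · rw [Nat.add_mul_div_left _ _ (by omega), Nat.div_eq_of_lt (by omega), zero_add]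
  · have h1 : 2 * i + (Z + 2 * (r * J)) ≡
        2 * (r * Z + (N - 1) * (r * J)) + (Z + 2 * (r * J)) [MOD N] :=
      ((Nat.mod_modEq _ N).mul_left 2).add_right _
    have h2 : 2 * (r * Z + (N - 1) * (r * J)) + (Z + 2 * (r * J)) =
        (2 * r + 1) * Z + N * (2 * (r * J)) := by
      obtain ⟨M, rfl⟩ := Nat.exists_eq_add_of_lt hN
      simp only [zero_add, add_tsub_cancel_right]
      ring
    rw [h2] at h1
    have h3 : N ∣ (2 * r + 1) * Z + N * (2 * (r * J)) :=
      dvd_add (hinv.mul_right _) (Dvd.intro _ rfl)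
    rw [show Z + 2 * (i + r * J) = 2 * i + (Z + 2 * (r * J)) by ring]
    exact (h1.dvd_iff dvd_rfl).2 h3

/-- The difference of two cut weights contributed by the `m`-th point of the lattice line through
`(X, Y)`, when `p = 2h + 1` and `q = kp + 2`. -/
def lineTerm (h k J X Y m : ℕ) : ℤ :=
  cutWeight (2 * h + 1) (k * (2 * h + 1) + 2) (k * h + 1) (h + 1) J
      ((X + (2 * k * h + 2) * m) % (k * (2 * h + 1) + 2)) ((Y + m) % (2 * h + 1)) -
    cutWeight (2 * h + 1) (k * (2 * h + 1) + 2) (k * h + 1) (h + 1) J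
      ((X + (2 * k * h + 2) * m) % (k * (2 * h + 1) + 2)) (((Y + m) % (2 * h + 1) + 2) % (2 * h + 1))

theorem lineTerm_eq_top {h k m : ℕ} (hh : 2 ≤ h) (hk : 0 < k) (hm : m < 2 * h + 1) :
    lineTerm h k (h * (k * (2 * h + 1) + 2)) (k * h) 0 m =
      if (0 + m) % (2 * h + 1) < h + 1 then 1 else 0 := by
  rw [lineTerm, zero_add, Nat.mod_eq_of_lt hm]
  have hlt : h < k * (2 * h + 1) + 2 := by nlinarith
  rcases le_or_gt m h with hmh | hmh
  · obtain ⟨d, hd⟩ := Nat.exists_eq_add_of_le hmh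
    have hkd : k * d ≤ k * h := Nat.mul_le_mul_left _ (by omega)
    have hx : (k * h + (2 * k * h + 2) * m) % (k * (2 * h + 1) + 2) = k * d := by
      rw [show k * h + (2 * k * h + 2) * m = k * d + (k * (2 * h + 1) + 2) * m by subst hd; ring,
        Nat.add_mul_mod_self_left, Nat.mod_eq_of_lt (by nlinarith)]
    have e1 : k * d * (2 * h + 1) + m * (k * (2 * h + 1) + 2) + 2 * d =
        h * (k * (2 * h + 1) + 2) := by subst hd; ring
    rw [hx, Nat.mod_eq_of_lt (show m + 2 < 2 * h + 1 by omega)]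
    unfold cutWeight binWeight binExp
    rw [add_mul m 2]
    generalize k * (2 * h + 1) + 2 = q at *
    split_ifs <;> omega
  · obtain ⟨d, hd⟩ := Nat.exists_eq_add_of_lt hmh
    obtain ⟨c, hc⟩ := Nat.exists_eq_add_of_lt (show d < h by omega)
    have hx : (k * h + (2 * k * h + 2) * m) % (k * (2 * h + 1) + 2) = k * (h + c + 1) + 2 := by
      rw [show k * h + (2 * k * h + 2) * m =
          k * (h + c + 1) + 2 + (k * (2 * h + 1) + 2) * (h + d) by subst hd; subst hc; ring,
        Nat.add_mul_mod_self_left, Nat.mod_eq_of_lt]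
      have : k * (h + c + 1) < k * (2 * h + 1) := Nat.mul_lt_mul_of_pos_left (by omega) hk
      omega
    have e1 : (k * (h + c + 1) + 2) * (2 * h + 1) + m * (k * (2 * h + 1) + 2) =
        (2 * h + 1) * (k * (2 * h + 1) + 2) + h * (k * (2 * h + 1) + 2) + 2 * (d + 1) := by
      subst hd; subst hc; ring
    have hμ : k * h + 1 ≤ k * (h + c + 1) + 2 := by nlinarith
    rw [hx]
    rcases lt_or_ge (m + 2) (2 * h + 1) with hlt' | hge
    · rw [Nat.mod_eq_of_lt hlt']
      unfold cutWeight binWeight binExp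
      rw [add_mul m 2]
      generalize k * (2 * h + 1) + 2 = q at *
      generalize k * (h + c + 1) + 2 = x at *
      split_ifs <;> omega
    · rw [Nat.mod_eq_sub_mod hge, Nat.mod_eq_of_lt (show m + 2 - (2 * h + 1) < 2 * h + 1 by omega)]
      unfold cutWeight binWeight binExp
      generalize k * (2 * h + 1) + 2 = q at *
      generalize k * (h + c + 1) + 2 = x at *
      split_ifs <;> omega

theorem lineTerm_eq_bot {h k m : ℕ} (hh : 2 ≤ h) (hk : 0 < k) (hm : m < 2 * h + 1) :
    lineTerm h k ((h - 1) * (k * (2 * h + 1) + 2) + 1) (k * (2 * h - 1) + 1) (h + 1) m =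
      if (h + 1 + m) % (2 * h + 1) < h + 1 then 0 else -1 := by
  rw [lineTerm]
  obtain ⟨g, rfl⟩ := Nat.exists_eq_add_of_lt (show 0 < h by omega)
  simp only [zero_add, add_tsub_cancel_right]
  rw [show 2 * (g + 1) - 1 = 2 * g + 1 by omega, show 2 * (g + 1) + 1 = 2 * g + 3 by ring] at *
  rcases le_or_gt m g with hmg | hmg
  · obtain ⟨d, hd⟩ := Nat.exists_eq_add_of_le hmg
    have hx : (k * (2 * g + 1) + 1 + (2 * k * (g + 1) + 2) * m) % (k * (2 * g + 3) + 2) =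
        k * (g + 1 + d) + 1 := by
      rw [show k * (2 * g + 1) + 1 + (2 * k * (g + 1) + 2) * m =
          k * (g + 1 + d) + 1 + (k * (2 * g + 3) + 2) * m by subst hd; ring,
        Nat.add_mul_mod_self_left, Nat.mod_eq_of_lt]
      have : k * (g + 1 + d) ≤ k * (2 * g + 3) := Nat.mul_le_mul_left _ (by omega)
      omega
    have e1 : (k * (g + 1 + d) + 1) * (2 * g + 3) + (g + 1 + 1 + m) * (k * (2 * g + 3) + 2) + 2 * d =
        (2 * g + 3) * (k * (2 * g + 3) + 2) + g * (k * (2 * g + 3) + 2) + 1 := by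
      subst hd; ring
    have hμ : k * (g + 1) + 1 ≤ k * (g + 1 + d) + 1 := by nlinarith
    have hq : g < k * (2 * g + 3) + 2 := by nlinarith
    rw [hx, Nat.mod_eq_of_lt (show g + 1 + 1 + m < 2 * g + 3 by omega)]
    rcases lt_or_ge (g + 1 + 1 + m + 2) (2 * g + 3) with hlt' | hge
    · rw [Nat.mod_eq_of_lt hlt']
      unfold cutWeight binWeight binExp
      rw [add_mul (g + 1 + 1 + m) 2]
      generalize k * (2 * g + 3) + 2 = q at *
      generalize k * (g + 1 + d) + 1 = x at *
      generalize g + 1 + 1 + m = y at *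
      split_ifs <;> omega
    · rw [Nat.mod_eq_sub_mod hge,
        Nat.mod_eq_of_lt (show g + 1 + 1 + m + 2 - (2 * g + 3) < 2 * g + 3 by omega)]
      unfold cutWeight binWeight binExp
      generalize k * (2 * g + 3) + 2 = q at *
      generalize k * (g + 1 + d) + 1 = x at *
      split_ifs <;> omega
  · obtain ⟨i, hi⟩ := Nat.exists_eq_add_of_lt hmg
    have hy : (g + 1 + 1 + m) % (2 * g + 3) = i := by
      rw [show g + 1 + 1 + m = i + (2 * g + 3) by omega, Nat.add_mod_right,
        Nat.mod_eq_of_lt (by omega)]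
    rw [hy, Nat.mod_eq_of_lt (show i + 2 < 2 * g + 3 by omega)]
    rcases Nat.lt_or_ge g i with hig | hig
    · have hig' : i = g + 1 := by omega
      have hx : k * (2 * g + 1) + 1 + (2 * k * (g + 1) + 2) * m =
          k * (2 * g + 2) + 3 + (k * (2 * g + 3) + 2) * (2 * g + 1) := by
        subst hi; subst hig'; ring
      rw [hx, Nat.add_mul_mod_self_left]
      rcases Nat.eq_or_lt_of_le (Nat.succ_le_of_lt hk) with rfl | hk2
      · rw [show Nat.succ 0 * (2 * g + 2) + 3 = Nat.succ 0 * (2 * g + 3) + 2 by ring, Nat.mod_self]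
        have e1 : (g + 1) * (Nat.succ 0 * (2 * g + 3) + 2) =
          g * (Nat.succ 0 * (2 * g + 3) + 2) + (2 * g + 5) := by ring
        rw [← hig'] at e1
        unfold cutWeight binWeight binExp
        generalize Nat.succ 0 * (2 * g + 3) + 2 = q at *
        split_ifs <;> omega
      · have e1 : (k * (2 * g + 2) + 3) * (2 * g + 3) + (i + 2) * (k * (2 * g + 3) + 2) =
            (2 * g + 3) * (k * (2 * g + 3) + 2) + g * (k * (2 * g + 3) + 2) +
              2 * (k * (2 * g + 3) + 2) + (2 * g + 5) := by
          subst hig'; ring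
        have hμ : k * (g + 1) + 1 ≤ k * (2 * g + 2) + 3 := by nlinarith
        have hlt : k * (2 * g + 2) + 3 < k * (2 * g + 3) + 2 := by nlinarith
        rw [Nat.mod_eq_of_lt hlt]
        unfold cutWeight binWeight binExp
        generalize k * (2 * g + 3) + 2 = q at *
        generalize k * (2 * g + 2) + 3 = x at *
        split_ifs <;> omega
    · obtain ⟨d, hd⟩ := Nat.exists_eq_add_of_le hig
      have hx : (k * (2 * g + 1) + 1 + (2 * k * (g + 1) + 2) * m) % (k * (2 * g + 3) + 2) =
          k * d + 1 := by
        rw [show k * (2 * g + 1) + 1 + (2 * k * (g + 1) + 2) * m =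
            k * d + 1 + (k * (2 * g + 3) + 2) * m by subst hi; subst hd; ring,
          Nat.add_mul_mod_self_left, Nat.mod_eq_of_lt]
        have : k * d ≤ k * (2 * g + 3) := Nat.mul_le_mul_left _ (by omega)
        omega
      have e1 : (k * d + 1) * (2 * g + 3) + i * (k * (2 * g + 3) + 2) =
          g * (k * (2 * g + 3) + 2) + 2 * i + 3 := by
        subst hd; ring
      have hμ : k * d < k * (g + 1) := Nat.mul_lt_mul_of_pos_left (by omega) hk
      rw [hx]
      unfold cutWeight binWeight binExp
      rw [add_mul i 2]
      generalize k * (2 * g + 3) + 2 = q at *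
      split_ifs <;> omega

/-- If `p = 2h + 1 ≥ 5`, `q ≡ 2` modulo `p`, `q > 2` and `2r ≡ -1` modulo `pq` with `r ≥ pq`,
then the coefficients of `Q_{p,q,r}` are exactly the integers of `[-h, h + 1]`. -/
theorem coeffSet_eq_Icc {h k r : ℕ} (hh : 2 ≤ h) (hk : 0 < k)
    (hr : (2 * h + 1) * (k * (2 * h + 1) + 2) ≤ r)
    (hinv : (2 * h + 1) * (k * (2 * h + 1) + 2) ∣ 2 * r + 1) :
    coeffSet (2 * h + 1) (k * (2 * h + 1) + 2) r = Set.Icc (-(h : ℤ)) (h + 1) := by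
  obtain ⟨p, hp⟩ : ∃ p, p = 2 * h + 1 := ⟨_, rfl⟩
  obtain ⟨q, hq⟩ : ∃ q, q = k * (2 * h + 1) + 2 := ⟨_, rfl⟩
  rw [← hq, ← hp] at hr hinv ⊢
  have hp0 : 0 < p := by omega
  have hq0 : 0 < q := by omega
  have hpq0 : 0 < p * q := by positivity
  have hr0 : 0 < r := by omega
  have hcop : p.Coprime q := by
    rw [hq, ← hp, Nat.add_comm, Nat.coprime_add_mul_right_right, hp]
    simp
  have hrcop : ∀ m, m ∣ 2 * r + 1 → m.Coprime r := fun m hm =>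
    Nat.Coprime.coprime_dvd_left hm (by simp)
  have hpr := hrcop p ((Dvd.intro _ rfl).trans hinv)
  have hqr := hrcop q ((Dvd.intro_left _ rfl).trans hinv)
  have hlin : p * (k * h + 1) + q * (h + 1) = p * q + 1 := by subst hp; subst hq; ring
  have hμ : k * h + 1 ≤ q := by subst hq; nlinarith
  obtain ⟨hQ, hdeg⟩ := Qpoly_spec hp0 hq0 hr0 hpr hqr hμ (show h + 1 ≤ p by omega) hlin
  have hsum : p + q < p * q := by subst hp; nlinarith
  have hcoeff : ∀ n X Y : ℕ, p * q ∣ X * p + Y * q + 2 * n → (Qpoly p q r).coeff n =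
      ∑ m ∈ Finset.range p, lineTerm h k (n / r) X Y m := by
    intro n X Y hXY
    rw [coeff_eq_sum_congrSum hsum hQ]
    refine Finset.sum_congr rfl fun m _ => ?_
    have hstep : (X + (2 * k * h + 2) * m) * p + (Y + m) * q + 2 * n =
        X * p + Y * q + 2 * n + p * q * m + 2 * m := by subst hp; subst hq; ring
    have hzero : X * p + Y * q + 2 * n + p * q * m ≡ 0 [MOD p * q] :=
      Nat.modEq_zero_iff_dvd.2 (dvd_add hXY (Dvd.intro _ rfl))
    rw [congrSum_eq_cutWeight_of_dvd hp0 hq0 hr0 hcop hlin hinv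
        (X := X + (2 * k * h + 2) * m) (Y := Y + m),
      congrSum_eq_cutWeight_of_dvd hp0 hq0 hr0 hcop hlin hinv
        (X := X + (2 * k * h + 2) * m) (Y := Y + m + 2), lineTerm, ← hq, ← hp, Nat.mod_add_mod]
    · rw [add_mul (Y + m), show (X + (2 * k * h + 2) * m) * p + ((Y + m) * q + 2 * q) + 2 * n =
        X * p + Y * q + 2 * n + p * q * m + 2 * (m + q) by linarith]
      simpa using hzero.add_right (2 * (m + q))
    · rw [hstep]
      simpa using hzero.add_right (2 * m)
  have hexists : ∀ n, ∃ X Y, p * q ∣ X * p + Y * q + 2 * n := by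
    intro n
    refine ⟨2 * n * (p * q - 1) * (k * h + 1), 2 * n * (p * q - 1) * (h + 1), 2 * n * (p * q), ?_⟩
    obtain ⟨N, hN⟩ := Nat.exists_eq_add_of_lt hpq0
    simp only [zero_add] at hN
    rw [hN] at hlin ⊢
    rw [add_tsub_cancel_right]
    linear_combination 2 * n * N * hlin
  have hcount := sum_range_ite_mod_lt (show h + 1 ≤ p by omega)
  have hcount' : ∀ Y, ∑ m ∈ Finset.range p, (if (Y + m) % p < h + 1 then (0 : ℤ) else -1) = -h := by
    intro Y
    have : ∀ m, (if (Y + m) % p < h + 1 then (0 : ℤ) else -1) =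
        (if (Y + m) % p < h + 1 then (1 : ℤ) else 0) - 1 := fun m => by split_ifs <;> rfl
    simp only [this, Finset.sum_sub_distrib, hcount]
    simp [hp]
    ring
  have hbound : ∀ n, (Qpoly p q r).coeff n ∈ Set.Icc (-(h : ℤ)) (h + 1) := by
    intro n
    obtain ⟨X, Y, hXY⟩ := hexists n
    have hterm : ∀ m, _ := fun m => cutWeight_sub_shift_bounds (q := q) (μ := k * h + 1)
      (J := n / r) (x := (X + (2 * k * h + 2) * m) % q) hh
      (show (Y + m) % (2 * h + 1) < 2 * h + 1 from Nat.mod_lt _ (by omega))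
    rw [hcoeff n X Y hXY]
    constructor
    · rw [← hcount' Y]
      refine Finset.sum_le_sum fun m _ => ?_
      rw [lineTerm, hp, ← hq]
      exact (hterm m).1
    · have := hcount Y
      push_cast at this
      rw [← this]
      refine Finset.sum_le_sum fun m _ => ?_
      rw [lineTerm, hp, ← hq]
      exact (hterm m).2
  have hjump : ∀ n, |(Qpoly p q r).coeff (n + 1) - (Qpoly p q r).coeff n| ≤ 1 := by
    intro n
    obtain ⟨X, Y, hXY⟩ := hexists (n + 1)
    have hzero := Nat.modEq_zero_iff_dvd.2 hXY
    rw [coeff_succ_sub_coeff hsum hQ,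
      congrSum_eq_cutWeight_of_dvd hp0 hq0 hr0 hcop hlin hinv (X := X) (Y := Y),
      congrSum_eq_cutWeight_of_dvd hp0 hq0 hr0 hcop hlin hinv (X := X + 2) (Y := Y),
      congrSum_eq_cutWeight_of_dvd hp0 hq0 hr0 hcop hlin hinv (X := X) (Y := Y + 2),
      congrSum_eq_cutWeight_of_dvd hp0 hq0 hr0 hcop hlin hinv (X := X + 2) (Y := Y + 2)]
    · exact abs_cutWeight_corners_le_one _ _ _ _ _ _ _ _ _
    · rw [show (X + 2) * p + (Y + 2) * q + 2 * (n + 1) =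
        X * p + Y * q + 2 * (n + 1) + 2 * (p + q) by ring]
      simpa using hzero.add_right (2 * (p + q))
    · rw [show X * p + (Y + 2) * q + 2 * (n + 1) = X * p + Y * q + 2 * (n + 1) + 2 * q by ring]
      simpa using hzero.add_right (2 * q)
    · rw [show (X + 2) * p + Y * q + 2 * (n + 1) = X * p + Y * q + 2 * (n + 1) + 2 * p by ring]
      simpa using hzero.add_right (2 * p)
    · simpa using hzero
  obtain ⟨M, hMJ, hM⟩ := exists_div_eq_and_dvd hpq0 hr hinv ((h - 1) * q + 1)
    ((k * (2 * h - 1) + 1) * p + (h + 1) * q)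
  obtain ⟨N, hNJ, hN⟩ := exists_div_eq_and_dvd hpq0 hr hinv (h * q) (k * h * p + 0 * q)
  have hMval : (Qpoly p q r).coeff M = -h := by
    rw [hcoeff M _ _ hM, ← hcount' (h + 1)]
    refine Finset.sum_congr rfl fun m hm => ?_
    rw [Finset.mem_range, hp] at hm
    rw [hMJ, hq, lineTerm_eq_bot hh hk hm, hp]
  have hNval : (Qpoly p q r).coeff N = h + 1 := by
    rw [hcoeff N _ _ hN]
    refine Eq.trans (Finset.sum_congr rfl fun m hm => ?_) ((hcount 0).trans (by push_cast; rfl))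
    rw [Finset.mem_range, hp] at hm
    rw [hNJ, hq, lineTerm_eq_top hh hk hm, hp]
  ext v
  constructor
  · rintro ⟨n, -, rfl⟩
    exact hbound n
  · rintro ⟨hv1, hv2⟩
    obtain ⟨n, hn, hnv⟩ := exists_eq_of_abs_sub_le_one_of_mem hjump
      (hMval.le.trans hv1) (hv2.trans hNval.ge)
    refine ⟨n, hn.trans ((max_le ?_ ?_).trans hdeg), hnv⟩
    · exact le_natDegree_of_ne_zero (by rw [hMval]; omega)
    · exact le_natDegree_of_ne_zero (by rw [hNval]; omega)

theorem eleven_pow_two_mul_three_pow_eq (a : ℕ) :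
    ∃ u : ℤ, (11 : ℤ) ^ (2 * 3 ^ a) = 1 + 3 ^ (a + 1) * (3 * u + 1) := by
  induction a with
  | zero => exact ⟨13, by norm_num⟩
  | succ a ih =>
    obtain ⟨u, hu⟩ := ih
    refine ⟨u + 3 ^ a * (3 * u + 1) ^ 2 + 3 ^ (2 * a) * (3 * u + 1) ^ 3, ?_⟩
    rw [pow_succ 3 a, ← mul_assoc, pow_mul, hu]
    ring

theorem exists_three_pow_dvd_eleven_pow_sub_two (a : ℕ) :
    ∃ b : ℕ, 0 < b ∧ (3 : ℤ) ^ (a + 1) ∣ 11 ^ b - 2 := by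
  induction a with
  | zero => exact ⟨1, one_pos, by norm_num⟩
  | succ a ih =>
    obtain ⟨b, hb, v, hv⟩ := ih
    obtain ⟨u, hu⟩ := eleven_pow_two_mul_three_pow_eq a
    have step (w : ℤ) (c : ℕ) (hw : (11 : ℤ) ^ c - 2 = 3 ^ (a + 1) * w) :
        ∃ t : ℤ, (11 : ℤ) ^ (c + 2 * 3 ^ a) - 2 = 3 ^ (a + 1) * (w + 2 + 3 * t) := by
      refine ⟨2 * u + 3 ^ a * w * (3 * u + 1), ?_⟩
      rw [pow_add, hu, eq_add_of_sub_eq hw]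
      ring
    obtain ⟨t, ht⟩ := step v b hv
    obtain ⟨t', ht'⟩ := step _ _ ht
    have h3 : (3 : ℤ) ∣ v ∨ 3 ∣ v + 2 + 3 * t ∨ 3 ∣ v + 2 + 3 * t + 2 + 3 * t' := by omega
    rcases h3 with h3 | h3 | h3
    · exact ⟨b, hb, by rw [hv, pow_succ _ (a + 1)]; exact mul_dvd_mul_left _ h3⟩
    · exact ⟨b + 2 * 3 ^ a, by omega, by rw [ht, pow_succ _ (a + 1)]; exact mul_dvd_mul_left _ h3⟩
    · exact ⟨b + 2 * 3 ^ a + 2 * 3 ^ a, by omega, by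
        rw [ht', pow_succ _ (a + 1)]; exact mul_dvd_mul_left _ h3⟩

/-- The power of `2` used for `r`: it is large and inverse to `-2` modulo `3^a 11^b`. -/
theorem exists_two_pow_dvd (a b : ℕ) :
    ∃ c : ℕ, 3 ^ (a + 1) * 11 ^ (b + 1) ≤ 2 ^ c ∧ 3 ^ (a + 1) * 11 ^ (b + 1) ∣ 2 * 2 ^ c + 1 := by
  have h3 : (3 : ℤ) ^ (a + 1) ∣ 2 ^ 3 ^ a + 1 := by
    have h := dvd_sub_pow_of_dvd_sub (R := ℤ) (p := 3) (a := 2) (b := -1) (by norm_num) a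
    rwa [(Odd.pow (by decide : Odd 3)).neg_one_pow, sub_neg_eq_add] at h
  have h11 : (11 : ℤ) ^ (b + 1) ∣ (2 ^ 5) ^ 11 ^ b + 1 := by
    have h := dvd_sub_pow_of_dvd_sub (R := ℤ) (p := 11) (a := 2 ^ 5) (b := -1) (by norm_num) b
    rwa [(Odd.pow (by decide : Odd 11)).neg_one_pow, sub_neg_eq_add] at h
  have hoddpow {d z : ℤ} {m : ℕ} (hm : Odd m) (hz : d ∣ z + 1) : d ∣ z ^ m + 1 :=
    hz.trans (by simpa using hm.add_dvd_pow_add_pow z 1)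
  set B := 3 ^ (a + 1) * 11 ^ (b + 1) with hB
  have hBodd : Odd B := (Odd.pow (by decide)).mul (Odd.pow (by decide))
  set N := 3 ^ a * (5 * 11 ^ b) * B with hN
  have h5 : Odd (5 * 11 ^ b) := Odd.mul (by decide) (Odd.pow (by decide))
  have h3a : Odd (3 ^ a) := Odd.pow (by decide)
  have d3 : (3 : ℤ) ^ (a + 1) ∣ 2 ^ N + 1 := by
    rw [hN, mul_assoc, pow_mul]
    exact hoddpow (h5.mul hBodd) h3
  have d11 : (11 : ℤ) ^ (b + 1) ∣ 2 ^ N + 1 := by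
    rw [hN, show 3 ^ a * (5 * 11 ^ b) * B = 5 * (11 ^ b * (3 ^ a * B)) by ring, pow_mul,
      pow_mul]
    exact hoddpow (h3a.mul hBodd) h11
  have hdvd : B ∣ 2 ^ N + 1 := by
    refine Nat.Coprime.mul_dvd_of_dvd_of_dvd (Nat.Coprime.pow _ _ (by norm_num)) ?_ ?_
    · exact_mod_cast d3
    · exact_mod_cast d11
  have hBpos : 0 < B := by positivity
  have hNB : B < N := by
    have : 0 < 3 ^ a * 11 ^ b := by positivity
    have : N = 5 * (3 ^ a * 11 ^ b) * B := by rw [hN]; ring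
    nlinarith
  refine ⟨N - 1, ?_, ?_⟩
  · exact Nat.lt_two_pow_self.le.trans (Nat.pow_le_pow_right two_pos (by omega))
  · rwa [← pow_succ', Nat.sub_add_cancel (by omega)]

/-- The coefficient of degree `n` in `Q_{3,11,128}` as a function of `J = n / 128` and
`m = n % 33`. -/
def coeffThreeEleven (J m : ℕ) : ℤ :=
  ∑ i ∈ Finset.range 3,
    (cutWeight 3 11 4 2 J ((10 * m + i) % 11) ((m + 2 * i) % 3) -
      cutWeight 3 11 4 2 J ((10 * m + (i + 11)) % 11) ((m + 2 * (i + 11)) % 3))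

theorem coeff_Qpoly_three_eleven (n : ℕ) :
    (Qpoly 3 11 128).coeff n = coeffThreeEleven (n / 128) (n % 33) := by
  have hQ := (Qpoly_spec (p := 3) (q := 11) (r := 128) (μ := 4) (l := 2) (by norm_num)
    (by norm_num) (by norm_num) (by norm_num) (by norm_num) (by norm_num) (by norm_num)
    (by norm_num)).1
  have hc : ∀ d, congrSum 3 11 128 4 2 n d =
      cutWeight 3 11 4 2 (n / 128) ((10 * (n % 33) + d) % 11) ((n % 33 + 2 * d) % 3) := fun d =>
    congrSum_eq_cutWeight (β := 8) (by norm_num) (by norm_num) (by norm_num) (by norm_num)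
      (by norm_num) (by norm_num) (by push_cast; omega)
  rw [coeff_eq_sum_congrSum (by norm_num) hQ]
  simp only [hc, coeffThreeEleven]

theorem coeffSet_three_eleven : coeffSet 3 11 128 = Set.Icc (-1) 2 := by
  have hbound : ∀ J < 20, ∀ m < 33, -1 ≤ coeffThreeEleven J m ∧ coeffThreeEleven J m ≤ 2 := by
    decide +kernel
  ext v
  constructor
  · rintro ⟨n, hn, rfl⟩
    rw [coeff_Qpoly_three_eleven]
    exact hbound _ (by omega) _ (by omega)
  · rintro ⟨h1, h2⟩
    interval_cases v
    · exact ⟨11, by norm_num, by rw [coeff_Qpoly_three_eleven]; decide +kernel⟩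
    · exact ⟨3, by norm_num, by rw [coeff_Qpoly_three_eleven]; decide +kernel⟩
    · exact ⟨0, by norm_num, by rw [coeff_Qpoly_three_eleven]; decide +kernel⟩
    · exact ⟨768, by norm_num, by rw [coeff_Qpoly_three_eleven]; decide +kernel⟩

theorem stmt_17 : ∀ a : ℕ, 0 < a → ∃ b c : ℕ, 0 < b ∧ 0 < c ∧ 2 < 2 ^ c ∧
    coeffSet (3 ^ a) (11 ^ b) (2 ^ c) =
      {n : ℤ | -((3 : ℤ) ^ a - 1) ≤ 2 * n ∧ 2 * n ≤ (3 : ℤ) ^ a + 1} := by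
  intro a ha
  obtain ⟨a, rfl⟩ := Nat.exists_eq_succ_of_ne_zero ha.ne'
  rcases Nat.eq_zero_or_pos a with rfl | ha'
  · refine ⟨1, 7, by norm_num, by norm_num, by norm_num, ?_⟩
    norm_num only [Nat.succ_eq_add_one]
    rw [coeffSet_three_eleven]
    ext v
    simp only [Set.mem_Icc, Set.mem_ofPred_eq]
    omega
  obtain ⟨b, hb, hdvd⟩ := exists_three_pow_dvd_eleven_pow_sub_two a
  obtain ⟨b, rfl⟩ := Nat.exists_eq_succ_of_ne_zero hb.ne'
  obtain ⟨c, hc, hinv⟩ := exists_two_pow_dvd a b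
  obtain ⟨h, hh⟩ : Odd (3 ^ (a + 1)) := Odd.pow (by decide)
  have h11 : 11 ≤ 11 ^ (b + 1) := Nat.le_self_pow (by omega) 11
  have h9 : 3 ^ 2 ≤ 3 ^ (a + 1) := Nat.pow_le_pow_right (by norm_num) (by omega)
  have hdvd' : 3 ^ (a + 1) ∣ 11 ^ (b + 1) - 2 := by
    zify [show 2 ≤ 11 ^ (b + 1) by omega]
    exact hdvd
  obtain ⟨k, hk⟩ := hdvd'
  have hq : 11 ^ (b + 1) = k * (2 * h + 1) + 2 := by
    rw [hh, mul_comm] at hk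
    omega
  have hk0 : 0 < k := by
    rcases Nat.eq_zero_or_pos k with rfl | hk0
    · omega
    · exact hk0
  have hc2 : 2 < 2 ^ c := by nlinarith
  refine ⟨b + 1, c, hb, Nat.pos_of_ne_zero ?_, hc2, ?_⟩
  · rintro rfl
    norm_num at hc2
  have hhz : (3 : ℤ) ^ (a + 1) = 2 * h + 1 := by exact_mod_cast hh
  rw [hq, hh] at hc hinv
  rw [Nat.succ_eq_add_one, hhz, hq, hh, coeffSet_eq_Icc (by omega) hk0 hc hinv]
  ext v
  simp only [Set.mem_Icc, Set.mem_ofPred_eq]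
  omega
end
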